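/- Fix n ≥ 1 and δ ∈ (0, π/3]. For q ≥ 3 and ρ > 0, let X_{q,δ,ρ} be the set of triangle patches 𝒯 = {K_1,…,K_q} around z = (0,0) with A_q on the positive x-axis, such that for every i the three interior angles α_i, β_i, γ_i of K_i (at z, A_{i−1}, A_i respectively) satisfy α_i, β_i, γ_i ≥ δ, and the edge lengths r_i := |A_i − z| satisfy r_i ≥ ρ. Let \tilde c_n(q,δ,ρ) := inf_{𝒯 ∈ X_{q,δ,ρ}} ĉ_n(𝒯). Then inf over all ρ > 0 and all integers q ≥ 3 of \tilde c_n(q,δ,ρ) is strictly positive. -/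

import Mathlib

open MeasureTheory Finset

noncomputable section

/-- 2×2 determinant of two vectors in `ℝ²`. -/
def det2 (u v : ℝ × ℝ) : ℝ := u.1 * v.2 - u.2 * v.1

/-- The open triangle with vertices `A`, `B`, `C` (interior of the convex hull). -/
def tri (A B C : ℝ × ℝ) : Set (ℝ × ℝ) := interior (convexHull ℝ {A, B, C})

/-- Barycentric coordinate of `p` with respect to the vertex `A` of triangle `ABC`. -/
def bary (A B C p : ℝ × ℝ) : ℝ := det2 (p - B) (C - B) / det2 (A - B) (C - B)

/-- The cubic bubble: product of the three barycentric coordinates of triangle `ABC`. -/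
def bubble (A B C p : ℝ × ℝ) : ℝ := bary A B C p * bary B C A p * bary C A B p

/-- Evaluation of a bivariate polynomial at a point of `ℝ²`. -/
def evalP (u : MvPolynomial (Fin 2) ℝ) (p : ℝ × ℝ) : ℝ :=
  MvPolynomial.eval ![p.1, p.2] u

/-- The inner product `(u,v)_K := ∫_K u v ω_K` on the open triangle `K = conv°(A,B,C)`,
with weight the product of the barycentric coordinates. -/
def innerT (A B C : ℝ × ℝ) (u v : MvPolynomial (Fin 2) ℝ) : ℝ :=
  ∫ p in tri A B C, evalP u p * evalP v p * bubble A B C p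

/-- `u ∈ P_{n-1}^⊥(K)` for `K = conv°(A,B,C)`: `u` has total degree at most `n` and is
orthogonal to every polynomial of total degree at most `n-1` w.r.t. `(·,·)_K`. -/
def inPerp (n : ℕ) (A B C : ℝ × ℝ) (u : MvPolynomial (Fin 2) ℝ) : Prop :=
  u.totalDegree ≤ n ∧
    ∀ w : MvPolynomial (Fin 2) ℝ, w.totalDegree ≤ n - 1 → innerT A B C u w = 0

/-- A triangle patch around a point `z`: `q ≥ 3` pairwise disjoint nondegenerate open
triangles `K_i = conv°(z, A_{i-1}, A_i)` (indices cyclic, i.e. in `ZMod q`), consecutive ones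
sharing the edge from `z` to `A_i`, whose closed union covers a neighbourhood of `z`. -/
structure TrianglePatch (q : ℕ) where
  hq : 3 ≤ q
  z : ℝ × ℝ
  A : ZMod q → ℝ × ℝ
  indep : ∀ i : ZMod q, AffineIndependent ℝ ![z, A (i - 1), A i]
  disj : Pairwise fun i j : ZMod q =>
    Disjoint (tri z (A (i - 1)) (A i)) (tri z (A (j - 1)) (A j))
  covers : ∃ ε > 0, Metric.ball z ε ⊆ ⋃ i : ZMod q, closure (tri z (A (i - 1)) (A i))

/-- The `i`-th triangle of a patch. -/
def TrianglePatch.K {q : ℕ} (T : TrianglePatch q) (i : ZMod q) : Set (ℝ × ℝ) :=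
  tri T.z (T.A (i - 1)) (T.A i)

/-- `Ω`: the interior of the union of the closed triangles of the patch. -/
def TrianglePatch.Omega {q : ℕ} (T : TrianglePatch q) : Set (ℝ × ℝ) :=
  interior (⋃ i : ZMod q, closure (tri T.z (T.A (i - 1)) (T.A i)))

/-- The patch inner product `(u,v)_𝒯 = Σ_i (u_i, v_i)_{K_i}` of two piecewise polynomials
(given as tuples of polynomials, one for each triangle). -/
def patchInner {q : ℕ} (T : TrianglePatch q)
    (u v : ZMod q → MvPolynomial (Fin 2) ℝ) : ℝ :=
  haveI : NeZero q := ⟨by have := T.hq; omega⟩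
  ∑ i : ZMod q, innerT T.z (T.A (i - 1)) (T.A i) (u i) (v i)

/-- Euclidean dot product on `ℝ²`. -/
def dot2 (u v : ℝ × ℝ) : ℝ := u.1 * v.1 + u.2 * v.2

/-- Euclidean norm on `ℝ²`. -/
def nrm2 (u : ℝ × ℝ) : ℝ := Real.sqrt (dot2 u u)

/-- The (unoriented) angle between two nonzero vectors of `ℝ²`. -/
def ang (u v : ℝ × ℝ) : ℝ := Real.arccos (dot2 u v / (nrm2 u * nrm2 v))

/-- Membership in `X_{q,δ,ρ}`: a triangle patch around `z = (0,0)` with `A_q` on the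
positive `x`-axis, all interior angles `α_i, β_i, γ_i` (at `z`, `A_{i-1}`, `A_i`) at
least `δ`, and all radii `r_i = |A_i - z|` at least `ρ`. -/
def goodPatch (q : ℕ) (del rho : ℝ) (T : TrianglePatch q) : Prop :=
  T.z = (0, 0) ∧ (T.A 0).2 = 0 ∧ 0 < (T.A 0).1 ∧
    ∀ i : ZMod q,
      del ≤ ang (T.A (i - 1) - T.z) (T.A i - T.z) ∧
      del ≤ ang (T.z - T.A (i - 1)) (T.A i - T.A (i - 1)) ∧
      del ≤ ang (T.z - T.A i) (T.A (i - 1) - T.A i) ∧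
      rho ≤ nrm2 (T.A i - T.z)

/-- `ĉ_n(𝒯)`: the infimum over nonzero `v ∈ P_n(Ω)` of `(v, Π_n^𝒯 v)_𝒯 / ‖v‖²_{L²(Ω)}`.
Here `(v, Π_n^𝒯 v)_𝒯 = ‖Π_n^𝒯 v‖²_𝒯 = ‖v‖²_𝒯 - dist_𝒯(v, P_{n-1}(𝒯))²`, and the
distance to `P_{n-1}(𝒯)` is expressed as an infimum over piecewise polynomials `w` of
degree `≤ n-1`. -/
def chat (n : ℕ) {q : ℕ} (T : TrianglePatch q) : ℝ :=
  sInf {r : ℝ | ∃ v : MvPolynomial (Fin 2) ℝ, v ≠ 0 ∧ v.totalDegree ≤ n ∧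
    r = (patchInner T (fun _ => v) (fun _ => v) -
          sInf {s : ℝ | ∃ w : ZMod q → MvPolynomial (Fin 2) ℝ,
            (∀ i, (w i).totalDegree ≤ n - 1) ∧
            s = patchInner T (fun i => v - w i) (fun i => v - w i)}) /
        ∫ p in T.Omega, (evalP v p) ^ 2}

open Polynomial in
lemma poly_eq_zero_of_integral_eq_zero (F : ℝ[X]) (w : ℝ → ℝ) (hw : Continuous w)
    (hpos : ∀ x ∈ Set.Ioo (0 : ℝ) 1, 0 < w x)
    (hF : ∀ x ∈ Set.Ioo (0 : ℝ) 1, 0 ≤ F.eval x)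
    (hint : ∫ x in (0 : ℝ)..1, F.eval x * w x = 0) : F = 0 := by
  have hcont : Continuous fun x => F.eval x * w x := F.continuous.mul hw
  have hz : ∀ x ∈ Set.Ioo (0 : ℝ) 1, F.eval x = 0 := by
    by_contra! hne
    obtain ⟨c, hc, hcne⟩ := hne
    have hnn : ∀ x ∈ Set.Icc (0 : ℝ) 1, 0 ≤ F.eval x * w x := by
      have hcl : IsClosed {x : ℝ | 0 ≤ F.eval x * w x} :=
        isClosed_le continuous_const hcont
      have : closure (Set.Ioo (0 : ℝ) 1) ⊆ {x : ℝ | 0 ≤ F.eval x * w x} :=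
        hcl.closure_subset_iff.2 fun x hx => mul_nonneg (hF x hx) (hpos x hx).le
      rwa [closure_Ioo zero_ne_one] at this
    have := intervalIntegral.integral_pos (zero_lt_one (α := ℝ)) hcont.continuousOn
      (fun x hx => hnn x (Set.Ioc_subset_Icc_self hx))
      ⟨c, Set.Ioo_subset_Icc_self hc,
        mul_pos (lt_of_le_of_ne (hF c hc) (Ne.symm hcne)) (hpos c hc)⟩
    linarith
  exact Polynomial.eq_zero_of_infinite_isRoot _
    ((Set.Ioo_infinite (zero_lt_one (α := ℝ))).mono hz)

open Polynomial in
lemma exists_sign_correcting_roots (d : ℕ) : ∀ f : ℝ[X], f ≠ 0 → f.natDegree ≤ d →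
    ∃ Z : Finset ℝ, (∀ z ∈ Z, z ∈ Set.Ioo (0 : ℝ) 1 ∧ f.eval z = 0) ∧
      ((∀ x ∈ Set.Ioo (0 : ℝ) 1, 0 ≤ (f * ∏ z ∈ Z, (X - C z)).eval x) ∨
       (∀ x ∈ Set.Ioo (0 : ℝ) 1, (f * ∏ z ∈ Z, (X - C z)).eval x ≤ 0)) := by
  have key : ∀ f : ℝ[X], (∀ x ∈ Set.Ioo (0 : ℝ) 1, f.eval x ≠ 0) →
      ((∀ x ∈ Set.Ioo (0 : ℝ) 1, 0 ≤ f.eval x) ∨ (∀ x ∈ Set.Ioo (0 : ℝ) 1, f.eval x ≤ 0)) := by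
    intro f hf
    by_contra! h
    obtain ⟨⟨x, hx, hx'⟩, y, hy, hy'⟩ := h
    obtain ⟨z, hz, hz'⟩ := isPreconnected_Ioo.intermediate_value hx hy f.continuous.continuousOn
      ⟨hx'.le, hy'.le⟩
    exact hf z hz hz'
  induction d with
  | zero =>
    intro f hf hd
    refine ⟨∅, by simp, ?_⟩
    have : f = C (f.coeff 0) := Polynomial.eq_C_of_natDegree_le_zero hd
    have hne : f.coeff 0 ≠ 0 := fun h => hf (by rw [this, h, map_zero])
    simpa using key f (fun x _ => by rw [this]; simpa using hne)
  | succ d ih =>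
    intro f hf hd
    by_cases hroot : ∃ z ∈ Set.Ioo (0 : ℝ) 1, f.eval z = 0
    · obtain ⟨z, hz, hfz⟩ := hroot
      obtain ⟨g, rfl⟩ := Polynomial.dvd_iff_isRoot.2 hfz
      have hg : g ≠ 0 := right_ne_zero_of_mul hf
      have hgd : g.natDegree ≤ d := by
        rw [Polynomial.natDegree_mul (Polynomial.X_sub_C_ne_zero z) hg,
          Polynomial.natDegree_X_sub_C] at hd
        omega
      obtain ⟨Z, hZ, hs⟩ := ih g hg hgd
      by_cases hzZ : z ∈ Z
      · refine ⟨Z.erase z, fun x hx => ?_, ?_⟩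
        · have := hZ x (Finset.mem_of_mem_erase hx)
          exact ⟨this.1, by rw [eval_mul, this.2, mul_zero]⟩
        · have : (X - C z) * g * ∏ x ∈ Z.erase z, (X - C x) = g * ∏ x ∈ Z, (X - C x) := by
            rw [← Finset.mul_prod_erase Z _ hzZ]; ring
          rwa [this]
      · refine ⟨insert z Z, fun x hx => ?_, ?_⟩
        · rcases Finset.mem_insert.1 hx with rfl | hx
          · exact ⟨hz, hfz⟩
          · have := hZ x hx
            exact ⟨this.1, by rw [eval_mul, this.2, mul_zero]⟩
        · have (x : ℝ) : ((X - C z) * g * ∏ x ∈ insert z Z, (X - C x)).eval x =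
              (x - z) ^ 2 * (g * ∏ x ∈ Z, (X - C x)).eval x := by
            rw [Finset.prod_insert hzZ]; simp only [eval_mul, eval_sub, eval_X, eval_C]; ring
          simp only [this]
          rcases hs with hs | hs
          · exact Or.inl fun x hx => mul_nonneg (sq_nonneg _) (hs x hx)
          · exact Or.inr fun x hx => mul_nonpos_of_nonneg_of_nonpos (sq_nonneg _) (hs x hx)
    · push Not at hroot
      exact ⟨∅, by simp, by simpa using key f hroot⟩

open Polynomial in
/-- A polynomial orthogonal on `(0,1)` to all polynomials of degree `< k` has at least `k`
distinct roots there. -/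
lemma exists_roots_of_orthogonal (f : ℝ[X]) (k : ℕ) (w : ℝ → ℝ) (hw : Continuous w)
    (hpos : ∀ x ∈ Set.Ioo (0 : ℝ) 1, 0 < w x)
    (horth : ∀ p : ℝ[X], p.natDegree < k → ∫ x in (0 : ℝ)..1, (f * p).eval x * w x = 0) :
    ∃ Z : Finset ℝ, k ≤ #Z ∧ ∀ z ∈ Z, z ∈ Set.Ioo (0 : ℝ) 1 ∧ f.eval z = 0 := by
  by_cases hf : f = 0
  · obtain ⟨Z, hZ, hk⟩ := (Set.Ioo_infinite (zero_lt_one (α := ℝ))).exists_subset_card_eq k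
    exact ⟨Z, hk.ge, fun z hz => ⟨hZ hz, by simp [hf]⟩⟩
  obtain ⟨Z, hZ, hs⟩ := exists_sign_correcting_roots _ f hf le_rfl
  refine ⟨Z, ?_, hZ⟩
  by_contra! hlt
  have hne : f * ∏ z ∈ Z, (X - C z) ≠ 0 :=
    mul_ne_zero hf (Finset.prod_ne_zero_iff.2 fun z _ => Polynomial.X_sub_C_ne_zero z)
  have h0 := horth (∏ z ∈ Z, (X - C z)) (by
    rw [Polynomial.natDegree_prod_of_monic _ _ fun z _ => Polynomial.monic_X_sub_C z]
    simpa using hlt)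
  rcases hs with hs | hs
  · exact hne (poly_eq_zero_of_integral_eq_zero _ w hw hpos hs h0)
  · refine hne (neg_eq_zero.1 (poly_eq_zero_of_integral_eq_zero _ w hw hpos
      (fun x hx => ?_) ?_))
    · rw [eval_neg]; linarith [hs x hx]
    · simpa only [eval_neg, neg_mul, intervalIntegral.integral_neg, neg_eq_zero] using h0

open Polynomial in
lemma radial_eq_zero_of_orthogonal (h g : ℝ[X]) (e : ℕ) (hg : h = X ^ (e + 1) * g)
    (horth : ∫ x in (0 : ℝ)..1, (h * (X ^ e * g)).eval x * (x ^ 3 * (1 - x)) = 0) : h = 0 := by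
  have : g * g = 0 := by
    refine poly_eq_zero_of_integral_eq_zero (g * g)
      (fun x => x ^ (2 * e + 1) * (x ^ 3 * (1 - x))) (by fun_prop) ?_ ?_ ?_
    · rintro x ⟨hx0, hx1⟩
      have : 0 < 1 - x := by linarith
      positivity
    · intro x _
      rw [eval_mul]; exact mul_self_nonneg _
    · refine Eq.trans ?_ horth
      rw [hg]
      congr 1
      ext x
      simp only [eval_mul, eval_pow, eval_X]
      ring
  rw [hg, mul_self_eq_zero.1 this, mul_zero]

open Polynomial in
/-- An orthogonal polynomial for the weight `x³(1-x)` has nonzero derivative at `0`. -/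
lemma radial_eq_zero_of_deriv (h : ℝ[X]) (n : ℕ) (hn : 1 ≤ n) (hd : h.natDegree ≤ n)
    (h1 : h.coeff 1 = 0)
    (horth : ∀ w : ℝ[X], w.natDegree < n →
      ∫ x in (0 : ℝ)..1, (h * w).eval x * (x ^ 3 * (1 - x)) = 0) : h = 0 := by
  obtain ⟨k, hk⟩ : X ∣ derivative h := by
    rw [Polynomial.X_dvd_iff, Polynomial.coeff_derivative]; simp [h1]
  have hd' : derivative h = 0 := by
    by_contra hne
    have hkne : k ≠ 0 := fun h => hne (by rw [hk, h, mul_zero])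
    have hkd : k.natDegree + 2 ≤ n := by
      have h2 := Polynomial.natDegree_derivative_lt (p := h) (fun h0 => hne (by
        rw [Polynomial.eq_C_of_natDegree_eq_zero h0, derivative_C]))
      rw [hk, Polynomial.natDegree_mul X_ne_zero hkne, natDegree_X] at h2
      omega
    have hkk : k * k = 0 := by
      refine poly_eq_zero_of_integral_eq_zero (k * k)
        (fun x => x * (x ^ 4 * (1 - x) ^ 2)) (by fun_prop) ?_ ?_ ?_
      · rintro x ⟨hx0, hx1⟩
        have : 0 < 1 - x := by linarith
        positivity
      · intro x _
        rw [eval_mul]; exact mul_self_nonneg _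
      · set W : ℝ[X] := k * (X ^ 4 * (1 - X) ^ 2) with hW
        have hW' : derivative W = (derivative k * (X * (1 - X)) + k * (4 * (1 - X) - 2 * X)) *
            (X ^ 3 * (1 - X)) := by
          rw [hW]
          simp only [derivative_mul, derivative_pow, derivative_X, derivative_sub,
            derivative_one, Nat.cast_ofNat, map_ofNat, Nat.add_one_sub_one]
          ring
        have hz := horth (derivative k * (X * (1 - X)) + k * (4 * (1 - X) - 2 * X)) (by
          refine lt_of_le_of_lt (b := k.natDegree + 1) ?_ (by omega)
          refine (Polynomial.natDegree_add_le _ _).trans (max_le ?_ ?_)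
          · by_cases hk0 : k.natDegree = 0
            · rw [Polynomial.eq_C_of_natDegree_eq_zero hk0]; simp
            · have := Polynomial.natDegree_derivative_lt hk0
              have h2 : (X * (1 - X) : ℝ[X]).natDegree ≤ 2 := by compute_degree
              have := Polynomial.natDegree_mul_le (p := derivative k) (q := X * (1 - X))
              omega
          · have h2 : (4 * (1 - X) - 2 * X : ℝ[X]).natDegree ≤ 1 := by compute_degree
            have := Polynomial.natDegree_mul_le (p := k) (q := (4 * (1 - X) - 2 * X : ℝ[X]))
            omega)
        have hparts := intervalIntegral.integral_mul_deriv_eq_deriv_mul (a := 0) (b := 1)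
          (u := fun x => h.eval x) (v := fun x => W.eval x)
          (u' := fun x => (derivative h).eval x) (v' := fun x => (derivative W).eval x)
          (fun x _ => h.hasDerivAt x) (fun x _ => W.hasDerivAt x)
          ((derivative h).continuous.intervalIntegrable _ _)
          ((derivative W).continuous.intervalIntegrable _ _)
        have e1 : ∫ x in (0 : ℝ)..1, h.eval x * (derivative W).eval x = 0 := by
          refine Eq.trans ?_ hz
          congr 1; ext x
          rw [hW']
          simp only [eval_mul, eval_pow, eval_X, eval_sub, eval_one]
          ring
        rw [e1] at hparts
        have e2 : W.eval 1 = 0 := by simp [hW]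
        have e3 : W.eval 0 = 0 := by simp [hW]
        rw [e2, e3] at hparts
        have e4 : ∫ x in (0 : ℝ)..1, (derivative h).eval x * W.eval x = 0 := by linarith
        refine Eq.trans ?_ e4
        rw [hk]
        congr 1; ext x
        simp only [hW, eval_mul, eval_pow, eval_X, eval_sub, eval_one]
        ring
    exact hkne (mul_self_eq_zero.1 hkk)
  have hc : h = C (h.coeff 0) :=
    Polynomial.eq_C_of_natDegree_eq_zero (Polynomial.derivative_eq_zero.1 hd')
  have hz := horth h (by rw [hc, natDegree_C]; omega)
  refine mul_self_eq_zero.1 (poly_eq_zero_of_integral_eq_zero (h * h)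
      (fun x => x ^ 3 * (1 - x)) (by fun_prop) ?_ ?_ hz)
  · rintro x ⟨hx0, hx1⟩
    have : 0 < 1 - x := by linarith
    positivity
  · intro x _
    rw [eval_mul]; exact mul_self_nonneg _

/-- The homogeneous form of degree `k` with coefficients `c`. -/
def homForm (c : ℕ × ℕ → ℝ) (k : ℕ) (p : ℝ × ℝ) : ℝ :=
  ∑ m ∈ antidiagonal k, c m * (p.1 ^ m.1 * p.2 ^ m.2)

lemma homForm_smul (c : ℕ × ℕ → ℝ) (k : ℕ) (r : ℝ) (p : ℝ × ℝ) :
    homForm c k (r • p) = r ^ k * homForm c k p := by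
  unfold homForm
  rw [Finset.mul_sum]
  refine Finset.sum_congr rfl fun m hm => ?_
  rw [← HasAntidiagonal.mem_antidiagonal.1 hm]
  simp only [Prod.smul_fst, Prod.smul_snd, smul_eq_mul]
  ring

lemma continuous_homForm (c : ℕ × ℕ → ℝ) (k : ℕ) : Continuous (homForm c k) := by
  unfold homForm
  fun_prop

open Polynomial in
/-- The restriction of a homogeneous form to the line `τ ↦ τ a + b`. -/
def linePoly (c : ℕ × ℕ → ℝ) (k : ℕ) (a b : ℝ × ℝ) : ℝ[X] :=
  ∑ m ∈ antidiagonal k, C (c m) * ((C a.1 * X + C b.1) ^ m.1 * (C a.2 * X + C b.2) ^ m.2)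

lemma eval_linePoly (c : ℕ × ℕ → ℝ) (k : ℕ) (a b : ℝ × ℝ) (t : ℝ) :
    (linePoly c k a b).eval t = homForm c k (t • a + b) := by
  simp only [linePoly, homForm, Polynomial.eval_finsetSum, Polynomial.eval_mul,
    Polynomial.eval_pow, Polynomial.eval_add, Polynomial.eval_C, Polynomial.eval_X,
    Prod.fst_add, Prod.snd_add, Prod.smul_fst, Prod.smul_snd, smul_eq_mul]
  refine Finset.sum_congr rfl fun m _ => ?_
  ring

open Polynomial in
lemma natDegree_linePoly_le (c : ℕ × ℕ → ℝ) (k : ℕ) (a b : ℝ × ℝ) :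
    (linePoly c k a b).natDegree ≤ k := by
  refine Polynomial.natDegree_sum_le_of_forall_le _ _ fun m hm => ?_
  refine (Polynomial.natDegree_C_mul_le _ _).trans ?_
  refine Polynomial.natDegree_mul_le.trans ?_
  rw [← HasAntidiagonal.mem_antidiagonal.1 hm]
  have h (u v : ℝ) (j : ℕ) : ((C u * X + C v) ^ j).natDegree ≤ j := by
    refine Polynomial.natDegree_pow_le.trans ?_
    simpa using Nat.mul_le_mul_left j (Polynomial.natDegree_linear_le (a := u) (b := v))
  exact add_le_add (h _ _ _) (h _ _ _)

open Polynomial in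
lemma coeff_eq_zero_of_homForm_eq_zero (c : ℕ × ℕ → ℝ) (k : ℕ) (h : ∀ p, homForm c k p = 0) :
    ∀ m ∈ antidiagonal k, c m = 0 := by
  have hP : (∑ m ∈ antidiagonal k, C (c m) * X ^ m.1 : ℝ[X]) = 0 := by
    refine Polynomial.funext fun x => ?_
    have := h (x, 1)
    simp only [homForm, one_pow, mul_one] at this
    simpa [Polynomial.eval_finsetSum] using this
  intro m hm
  have := congrArg (fun P : ℝ[X] => P.coeff m.1) hP
  simp only [Polynomial.finsetSum_coeff, Polynomial.coeff_C_mul, Polynomial.coeff_X_pow,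
    Polynomial.coeff_zero] at this
  rw [Finset.sum_eq_single m] at this
  · simpa using this
  · intro m' hm' hne
    rw [if_neg, mul_zero]
    intro heq
    apply hne
    rw [HasAntidiagonal.mem_antidiagonal] at hm hm'
    ext <;> omega
  · exact fun h => absurd hm h

/-- The open cone spanned by `a` and `b`. -/
def InCone (a b p : ℝ × ℝ) : Prop := 0 < det2 p b * det2 a b ∧ 0 < det2 a p * det2 a b

lemma inCone_comb {a b : ℝ × ℝ} (h : det2 a b ≠ 0) {s t : ℝ} (hs : 0 < s) (ht : 0 < t) :
    InCone a b (s • a + t • b) := by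
  have h2 : 0 < det2 a b * det2 a b := mul_self_pos.2 h
  have e1 : det2 (s • a + t • b) b * det2 a b = s * (det2 a b * det2 a b) := by
    simp [det2]; ring
  have e2 : det2 a (s • a + t • b) * det2 a b = t * (det2 a b * det2 a b) := by
    simp [det2]; ring
  exact ⟨e1 ▸ mul_pos hs h2, e2 ▸ mul_pos ht h2⟩

lemma InCone.smul {a b p : ℝ × ℝ} (h : InCone a b p) {r : ℝ} (hr : 0 < r) :
    InCone a b (r • p) := by
  have e1 : det2 (r • p) b * det2 a b = r * (det2 p b * det2 a b) := by simp [det2]; ring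
  have e2 : det2 a (r • p) * det2 a b = r * (det2 a p * det2 a b) := by simp [det2]; ring
  exact ⟨e1 ▸ mul_pos hr h.1, e2 ▸ mul_pos hr h.2⟩

/-- A form of degree `k ≥ 1` cannot have `k` zero rays in each of three disjoint cones. -/
lemma coeff_eq_zero_of_roots {ι : Type*} [Fintype ι] (hι : 3 ≤ Fintype.card ι)
    (a b : ι → ℝ × ℝ) (hdet : ∀ i, det2 (a i) (b i) ≠ 0)
    (hdisj : ∀ i j p, i ≠ j → InCone (a i) (b i) p → ¬ InCone (a j) (b j) p)
    (c : ℕ × ℕ → ℝ) (k : ℕ) (hk : 1 ≤ k) (Z : ι → Finset ℝ) (hcard : ∀ i, k ≤ #(Z i))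
    (hZ : ∀ i, ∀ z ∈ Z i, z ∈ Set.Ioo (0 : ℝ) 1 ∧ homForm c k (z • a i + (1 - z) • b i) = 0) :
    ∀ m ∈ antidiagonal k, c m = 0 := by
  refine coeff_eq_zero_of_homForm_eq_zero c k ?_
  by_contra! hne
  obtain ⟨d, hd⟩ := hne
  have hd0 : d ≠ 0 := by
    rintro rfl
    apply hd
    have := homForm_smul c k 0 0
    rwa [smul_zero, zero_pow (by omega), zero_mul] at this
  set e : ℝ × ℝ := (-d.2, d.1) with he
  have hD : 0 < det2 d e := by
    have : det2 d e = d.1 ^ 2 + d.2 ^ 2 := by simp [det2, he]; ring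
    rw [this]
    rcases eq_or_ne d.1 0 with h1 | h1
    · have h2 : d.2 ≠ 0 := fun h2 => hd0 (Prod.ext h1 h2)
      positivity
    · positivity
  have hdec (p : ℝ × ℝ) : p = (det2 p e / det2 d e) • d + (det2 d p / det2 d e) • e := by
    ext <;> simp only [Prod.fst_add, Prod.snd_add, Prod.smul_fst, Prod.smul_snd, smul_eq_mul] <;>
      field_simp <;> simp [det2, he] <;> ring
  set P := linePoly c k d e with hP
  have hP0 : P ≠ 0 := by
    intro h0
    have h1 : ∀ t : ℝ, t ≠ 0 → homForm c k (d + t • e) = 0 := by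
      intro t ht
      have : d + t • e = t • (t⁻¹ • d + e) := by rw [smul_add, smul_inv_smul₀ ht]
      rw [this, homForm_smul, ← eval_linePoly, ← hP, h0, Polynomial.eval_zero, mul_zero]
    have hcont : Continuous fun t : ℝ => homForm c k (d + t • e) :=
      (continuous_homForm c k).comp (by fun_prop)
    have h2 := Continuous.ext_on (dense_compl_singleton (0 : ℝ)) hcont continuous_const
      (fun t ht => h1 t ht)
    have := congrFun h2 0
    simp only [zero_smul, add_zero] at this
    exact hd this
  set pt : (Σ _ : ι, ℝ) → ℝ × ℝ := fun x => x.2 • a x.1 + (1 - x.2) • b x.1 with hpt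
  set T : Finset (Σ _ : ι, ℝ) := Finset.univ.sigma Z with hT
  have hy : ∀ x ∈ T, det2 d (pt x) ≠ 0 := by
    intro x hx h0
    have hx' := hZ x.1 x.2 (Finset.mem_sigma.1 hx).2
    have hp := hdec (pt x)
    rw [h0, zero_div, zero_smul, add_zero] at hp
    have h1 : homForm c k (pt x) = 0 := hx'.2
    rw [hp, homForm_smul] at h1
    have h2 : (det2 (pt x) e / det2 d e) = 0 := by
      rcases mul_eq_zero.1 h1 with h | h
      · exact eq_zero_of_pow_eq_zero h
      · exact absurd h hd
    rw [h2, zero_smul] at hp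
    have hc := (inCone_comb (hdet x.1) hx'.1.1 (sub_pos.2 hx'.1.2)).1
    change 0 < det2 (pt x) _ * _ at hc
    rw [hp] at hc
    simp [det2] at hc
  have hle : #T ≤ #(P.roots.toFinset ×ˢ (Finset.univ : Finset Bool)) := by
    refine Finset.card_le_card_of_injOn
      (fun x => (det2 (pt x) e / det2 d (pt x), decide (0 < det2 d (pt x)))) ?_ ?_
    · intro x hx
      have hx : x ∈ T := hx
      have hx' := hZ x.1 x.2 (Finset.mem_sigma.1 hx).2
      have hyx := hy x hx
      simp only [Finset.coe_product, Finset.coe_univ, Set.mem_prod, Set.mem_univ, and_true,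
        Finset.mem_coe, Multiset.mem_toFinset]
      rw [Polynomial.mem_roots hP0, Polynomial.IsRoot, hP, eval_linePoly]
      have : (det2 (pt x) e / det2 d (pt x)) • d + e =
          (det2 d e / det2 d (pt x)) • pt x := by
        refine Eq.trans ?_ (congrArg (fun v => (det2 d e / det2 d (pt x)) • v) (hdec (pt x)).symm)
        simp only [smul_add, smul_smul]
        congr 1
        · congr 1; field_simp
        · conv_lhs => rw [← one_smul ℝ e]
          congr 1; field_simp
      rw [this, homForm_smul]
      have h1 : homForm c k (pt x) = 0 := hx'.2
      rw [h1, mul_zero]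
    · intro x hx x' hx' heq
      have hx : x ∈ T := hx
      have hx' : x' ∈ T := hx'
      have hyx := hy x hx
      have hyx' := hy x' hx'
      simp only [Prod.mk.injEq, decide_eq_decide] at heq
      obtain ⟨h1, h2⟩ := heq
      set l := det2 d (pt x') / det2 d (pt x) with hl
      have hlpos : 0 < l := by
        rcases lt_or_gt_of_ne hyx with h | h
        · have : det2 d (pt x') < 0 :=
            lt_of_le_of_ne (not_lt.1 fun h' => absurd (h2.2 h') (not_lt.2 h.le)) hyx'
          exact div_pos_of_neg_of_neg this h
        · exact div_pos (h2.1 h) h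
      have hpp : pt x' = l • pt x := by
        rw [hdec (pt x'), hdec (pt x), smul_add, smul_smul, smul_smul]
        rw [div_eq_div_iff hyx hyx'] at h1
        congr 2
        · rw [hl]; field_simp; linarith
        · rw [hl]; field_simp
      have m := hZ x.1 x.2 (Finset.mem_sigma.1 hx).2
      have m' := hZ x'.1 x'.2 (Finset.mem_sigma.1 hx').2
      have hc : InCone (a x.1) (b x.1) (pt x) := inCone_comb (hdet _) m.1.1 (sub_pos.2 m.1.2)
      have hc' : InCone (a x'.1) (b x'.1) (pt x') :=
        inCone_comb (hdet _) m'.1.1 (sub_pos.2 m'.1.2)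
      have hxx : x.1 = x'.1 := by
        by_contra hne
        exact hdisj _ _ _ hne (hpp ▸ hc.smul hlpos) hc'
      obtain ⟨i, s⟩ := x
      obtain ⟨i', s'⟩ := x'
      simp only at hxx
      subst hxx
      have hdi := hdet i
      have g1 : det2 (pt ⟨i, s'⟩) (b i) = det2 (l • pt ⟨i, s⟩) (b i) := by rw [hpp]
      have g2 : det2 (a i) (pt ⟨i, s'⟩) = det2 (a i) (l • pt ⟨i, s⟩) := by rw [hpp]
      have k1 : s' * det2 (a i) (b i) = l * s * det2 (a i) (b i) := by
        simp only [hpt, det2, Prod.fst_add, Prod.snd_add, Prod.smul_fst, Prod.smul_snd,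
          smul_eq_mul] at g1 ⊢
        linarith
      have k2 : (1 - s') * det2 (a i) (b i) = l * (1 - s) * det2 (a i) (b i) := by
        simp only [hpt, det2, Prod.fst_add, Prod.snd_add, Prod.smul_fst, Prod.smul_snd,
          smul_eq_mul] at g2 ⊢
        linarith
      have k1' := mul_right_cancel₀ hdi k1
      have k2' := mul_right_cancel₀ hdi k2
      have : l = 1 := by linarith
      rw [this, one_mul] at k1'
      rw [k1']
  have h1 : 3 * k ≤ #T := by
    rw [hT, Finset.card_sigma]
    calc 3 * k ≤ Fintype.card ι * k := Nat.mul_le_mul_right k hι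
      _ = ∑ _i : ι, k := by simp
      _ ≤ _ := Finset.sum_le_sum fun i _ => hcard i
  have h2 : #(P.roots.toFinset) ≤ k :=
    (Multiset.toFinset_card_le _).trans ((Polynomial.card_roots' P).trans
      (natDegree_linePoly_le c k d e))
  rw [Finset.card_product] at hle
  simp only [Finset.card_univ, Fintype.card_bool] at hle
  omega

lemma homForm_one (c : ℕ × ℕ → ℝ) (p : ℝ × ℝ) :
    homForm c 1 p = c (1, 0) * p.1 + c (0, 1) * p.2 := by
  have : antidiagonal 1 = {((0 : ℕ), (1 : ℕ)), (1, 0)} := rfl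
  simp [homForm, this]
  ring

lemma homForm_zero_right (c : ℕ × ℕ → ℝ) (p : ℝ × ℝ) : homForm c 0 p = c (0, 0) := by
  simp [homForm]

/-- A nonzero linear form cannot have constant sums over consecutive vertices of a fan of
disjoint cones covering the plane. -/
lemma false_of_constant_consecutive_sum {q : ℕ} [NeZero q] (hq : 3 ≤ q) (A : ZMod q → ℝ × ℝ)
    (hdet : ∀ i, det2 (A (i - 1)) (A i) ≠ 0)
    (hdisj : ∀ i j p, i ≠ j → InCone (A (i - 1)) (A i) p → ¬ InCone (A (j - 1)) (A j) p)
    (hcov : ∀ p, ∃ i, 0 ≤ det2 p (A i) * det2 (A (i - 1)) (A i) ∧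
      0 ≤ det2 (A (i - 1)) p * det2 (A (i - 1)) (A i))
    (g : ℝ × ℝ) (hg : g ≠ 0) (K : ℝ) (hK : ∀ i, dot2 g (A (i - 1)) + dot2 g (A i) = K) :
    False := by
  wlog hK0 : 0 ≤ K generalizing g K
  · refine this (-g) (neg_ne_zero.2 hg) (-K) (fun i => ?_) (by linarith)
    rw [← hK i]; simp [dot2]; ring
  have hg2 : 0 < g.1 ^ 2 + g.2 ^ 2 := by
    rcases eq_or_ne g.1 0 with h1 | h1
    · have h2 : g.2 ≠ 0 := fun h2 => hg (Prod.ext h1 h2)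
      positivity
    · positivity
  by_cases hall : ∀ i, 0 ≤ dot2 g (A i)
  · obtain ⟨i, h1, h2⟩ := hcov (-g)
    have e : (det2 (-g) (A i) * det2 (A (i - 1)) (A i)) * dot2 g (A (i - 1)) +
        (det2 (A (i - 1)) (-g) * det2 (A (i - 1)) (A i)) * dot2 g (A i) =
        -(g.1 ^ 2 + g.2 ^ 2) * (det2 (A (i - 1)) (A i)) ^ 2 := by
      simp [dot2, det2]; ring
    have h3 := mul_nonneg h1 (hall (i - 1))
    have h4 := mul_nonneg h2 (hall i)
    have h5 : 0 < (g.1 ^ 2 + g.2 ^ 2) * (det2 (A (i - 1)) (A i)) ^ 2 :=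
      mul_pos hg2 (sq_pos_of_ne_zero (hdet i))
    linarith
  · push Not at hall
    obtain ⟨j, hj⟩ := hall
    set f : ZMod q → ℝ := fun i => dot2 g (A i) with hf
    have hP : ∀ i, f i = f j ∨ f i = K - f j := by
      have hind : ∀ m : ℕ, f (j + m) = f j ∨ f (j + m) = K - f j := by
        intro m
        induction m with
        | zero => simp
        | succ m ih =>
          have h := hK (j + (m + 1 : ℕ))
          have e : j + ((m + 1 : ℕ) : ZMod q) - 1 = j + m := by push_cast; ring
          rw [e] at h
          change f (j + m) + f (j + (m + 1 : ℕ)) = K at h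
          rcases ih with ih | ih
          · right; linarith
          · left; linarith
      intro i
      have := hind (i - j).val
      rwa [ZMod.natCast_zmod_val, add_sub_cancel] at this
    have hsign : ∀ i, f (i - 1) * f i < 0 := by
      intro i
      have hi : f (i - 1) + f i = K := hK i
      have hj' : f j < 0 := hj
      rcases hP (i - 1) with h | h
      · have : 0 < f i := by linarith
        rw [h]; exact mul_neg_of_neg_of_pos hj' this
      · have : f i = f j := by linarith
        rw [this, h]; exact mul_neg_of_pos_of_neg (by linarith) hj'
    have hc := coeff_eq_zero_of_roots (ι := ZMod q) (by rwa [ZMod.card])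
      (fun i => A (i - 1)) A hdet hdisj
      (fun m => if m = (1, 0) then g.1 else g.2) 1 le_rfl
      (fun i => {f i / (f i - f (i - 1))}) (fun i => by simp) (fun i z hz => by
        rw [Finset.mem_singleton.1 hz]
        have hs := hsign i
        have hne : f i - f (i - 1) ≠ 0 := by
          intro h0
          have : f i = f (i - 1) := by linarith
          rw [this] at hs
          nlinarith [mul_self_nonneg (f (i - 1))]
        have hz' : f i / (f i - f (i - 1)) * f (i - 1) +
            (1 - f i / (f i - f (i - 1))) * f i = 0 := by
          field_simp; ring
        refine ⟨?_, ?_⟩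
        · rcases mul_neg_iff.1 hs with h | h
          · exact ⟨div_pos_of_neg_of_neg h.2 (by linarith), by
              rw [div_lt_one_of_neg (by linarith)]; linarith⟩
          · exact ⟨div_pos h.2 (by linarith), by rw [div_lt_one (by linarith)]; linarith⟩
        · rw [homForm_one, ← hz']
          simp [hf, dot2]; ring)
    have h1 := hc (1, 0) (by simp)
    have h2 := hc (0, 1) (by simp)
    simp at h1 h2
    exact hg (Prod.ext h1 h2)

open Polynomial in
/-- Angular moment of the degree `k` form over the cone spanned by `a` and `b`. -/
def angMoment (c : ℕ × ℕ → ℝ) (k : ℕ) (a b : ℝ × ℝ) (p : ℝ[X]) : ℝ :=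
  ∫ x in (0 : ℝ)..1, (linePoly c k (a - b) b * p).eval x * (x * (1 - x))

/-- Radial moment. -/
def radMoment (N : ℕ) : ℝ := ∫ x in (0 : ℝ)..1, x ^ N * (x ^ 3 * (1 - x))

open Polynomial in
lemma integral_mul_poly_expand (F p : ℝ[X]) (w : ℝ → ℝ) (hw : Continuous w) (N : ℕ)
    (hp : p.natDegree < N) :
    ∫ x in (0 : ℝ)..1, (F * p).eval x * w x =
      ∑ e ∈ range N, p.coeff e * ∫ x in (0 : ℝ)..1, (F * X ^ e).eval x * w x := by
  simp_rw [← intervalIntegral.integral_const_mul]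
  rw [← intervalIntegral.integral_finsetSum]
  · congr 1; ext x
    conv_lhs => rw [p.as_sum_range_C_mul_X_pow' hp]
    simp only [eval_mul, eval_finsetSum, eval_C, eval_pow, eval_X, Finset.mul_sum, Finset.sum_mul]
    exact Finset.sum_congr rfl fun _ _ => by ring
  · intro e _
    refine Continuous.intervalIntegrable ?_ _ _
    exact continuous_const.mul ((F * X ^ e).continuous.mul hw)

open Polynomial in
/-- The radial profile obtained by taking the angular moments against `p`. -/
def radialPoly (n : ℕ) (c : ℕ × ℕ → ℝ) (a b : ℝ × ℝ) (p : ℝ[X]) : ℝ[X] :=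
  ∑ k ∈ range (n + 1), C (angMoment c k a b p) * X ^ k

open Polynomial in
lemma coeff_radialPoly (n : ℕ) (c : ℕ × ℕ → ℝ) (a b : ℝ × ℝ) (p : ℝ[X]) (k : ℕ) :
    (radialPoly n c a b p).coeff k = if k ≤ n then angMoment c k a b p else 0 := by
  simp [radialPoly, finsetSum_coeff, coeff_X_pow]

open Polynomial in
lemma natDegree_radialPoly_le (n : ℕ) (c : ℕ × ℕ → ℝ) (a b : ℝ × ℝ) (p : ℝ[X]) :
    (radialPoly n c a b p).natDegree ≤ n := by
  rw [Polynomial.natDegree_le_iff_coeff_eq_zero]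
  intro k hk
  rw [coeff_radialPoly, if_neg (by omega)]

open Polynomial in
lemma radialPoly_orthogonal (n : ℕ) (c : ℕ × ℕ → ℝ) (a b : ℝ × ℝ)
    (horth : ∀ e M, e ≤ M → M < n →
      ∑ k ∈ range (n + 1), radMoment (k + M) * angMoment c k a b (X ^ e) = 0)
    (p : ℝ[X]) (e : ℕ) (hp : p.natDegree ≤ e) (w : ℝ[X]) (hw : (X ^ e * w).natDegree < n) :
    ∫ x in (0 : ℝ)..1, (radialPoly n c a b p * (X ^ e * w)).eval x * (x ^ 3 * (1 - x)) = 0 := by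
  rw [integral_mul_poly_expand _ _ _ (by fun_prop) n hw]
  refine Finset.sum_eq_zero fun M hM => ?_
  by_cases hMe : M < e
  · rw [Polynomial.coeff_X_pow_mul', if_neg (by omega), zero_mul]
  · refine mul_eq_zero_of_right _ ?_
    have h1 : ∫ x in (0 : ℝ)..1, (radialPoly n c a b p * X ^ M).eval x * (x ^ 3 * (1 - x)) =
        ∑ k ∈ range (n + 1), radMoment (k + M) * angMoment c k a b p := by
      simp_rw [radMoment, ← intervalIntegral.integral_mul_const]
      rw [← intervalIntegral.integral_finsetSum]
      · congr 1; ext x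
        simp only [radialPoly, eval_mul, eval_finsetSum, eval_C, eval_pow, eval_X,
          Finset.sum_mul]
        exact Finset.sum_congr rfl fun _ _ => by ring
      · intro k _
        exact Continuous.intervalIntegrable (by fun_prop) _ _
    rw [h1]
    have h2 (k : ℕ) : angMoment c k a b p =
        ∑ j ∈ range (M + 1), p.coeff j * angMoment c k a b (X ^ j) :=
      integral_mul_poly_expand _ _ _ (by fun_prop) _ (by omega)
    simp_rw [h2, Finset.mul_sum]
    rw [Finset.sum_comm]
    refine Finset.sum_eq_zero fun j hj => ?_
    rw [Finset.mem_range] at hj hM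
    have := horth j M (by omega) hM
    calc _ = p.coeff j * ∑ k ∈ range (n + 1), radMoment (k + M) * angMoment c k a b (X ^ j) := by
          rw [Finset.mul_sum]
          exact Finset.sum_congr rfl fun _ _ => by ring
      _ = 0 := by rw [this, mul_zero]

open Polynomial in
lemma radialPoly_eq_zero (n : ℕ) (c : ℕ × ℕ → ℝ) (a b : ℝ × ℝ)
    (horth : ∀ e M, e ≤ M → M < n →
      ∑ k ∈ range (n + 1), radMoment (k + M) * angMoment c k a b (X ^ e) = 0)
    (p : ℝ[X]) (e : ℕ) (hp : p.natDegree ≤ e)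
    (hlow : ∀ j ≤ e, angMoment c j a b p = 0) : radialPoly n c a b p = 0 := by
  obtain ⟨g, hg⟩ : X ^ (e + 1) ∣ radialPoly n c a b p := by
    rw [Polynomial.X_pow_dvd_iff]
    intro d hd
    rw [coeff_radialPoly]
    split_ifs
    · exact hlow d (by omega)
    · rfl
  by_cases hg0 : g = 0
  · rw [hg, hg0, mul_zero]
  refine radial_eq_zero_of_orthogonal _ g e hg
    (radialPoly_orthogonal n c a b horth p e hp g ?_)
  have := natDegree_radialPoly_le n c a b p
  rw [hg, Polynomial.natDegree_mul (pow_ne_zero _ X_ne_zero) hg0, natDegree_X_pow] at this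
  rw [Polynomial.natDegree_mul (pow_ne_zero _ X_ne_zero) hg0, natDegree_X_pow]
  omega

lemma angMoment_zero_one (c : ℕ × ℕ → ℝ) (a b : ℝ × ℝ) :
    angMoment c 0 a b 1 = c (0, 0) / 6 := by
  simp only [angMoment, mul_one, eval_linePoly, homForm_zero_right]
  rw [intervalIntegral.integral_const_mul]
  have : ∫ x in (0 : ℝ)..1, x * (1 - x) = 1 / 6 := by
    simp_rw [mul_sub, mul_one, ← sq]
    rw [intervalIntegral.integral_sub (Continuous.intervalIntegrable (by fun_prop) _ _)
      (Continuous.intervalIntegrable (by fun_prop) _ _)]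
    simp; norm_num
  rw [this]; ring

lemma angMoment_one_one (c : ℕ × ℕ → ℝ) (a b : ℝ × ℝ) :
    angMoment c 1 a b 1 = (dot2 (c (1, 0), c (0, 1)) a + dot2 (c (1, 0), c (0, 1)) b) / 12 := by
  simp only [angMoment, mul_one, eval_linePoly, homForm_one]
  set u := dot2 (c (1, 0), c (0, 1)) a with hu
  set v := dot2 (c (1, 0), c (0, 1)) b with hv
  have e : ∀ x : ℝ, (c (1, 0) * (x • (a - b) + b).1 + c (0, 1) * (x • (a - b) + b).2) *
      (x * (1 - x)) = v * x + (u - 2 * v) * x ^ 2 + (v - u) * x ^ 3 := by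
    intro x
    simp [hu, hv, dot2]; ring
  simp_rw [e]
  rw [intervalIntegral.integral_add (Continuous.intervalIntegrable (by fun_prop) _ _)
      (Continuous.intervalIntegrable (by fun_prop) _ _),
    intervalIntegral.integral_add (Continuous.intervalIntegrable (by fun_prop) _ _)
      (Continuous.intervalIntegrable (by fun_prop) _ _)]
  have e1 : ∫ x in (0 : ℝ)..1, v * x = v / 2 := by
    rw [intervalIntegral.integral_const_mul, integral_id]; ring
  rw [e1]
  simp only [intervalIntegral.integral_const_mul, integral_pow]
  norm_num; ring

open Polynomial in
/-- A polynomial of degree at most `n` orthogonal, on every triangle of a patch, to all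
polynomials of degree less than `n` vanishes. -/
lemma coeff_eq_zero_of_patch_orthogonal {q : ℕ} [NeZero q] (hq : 3 ≤ q) (n : ℕ) (hn : 1 ≤ n)
    (A : ZMod q → ℝ × ℝ)
    (hdet : ∀ i, det2 (A (i - 1)) (A i) ≠ 0)
    (hdisj : ∀ i j p, i ≠ j → InCone (A (i - 1)) (A i) p → ¬ InCone (A (j - 1)) (A j) p)
    (hcov : ∀ p, ∃ i, 0 ≤ det2 p (A i) * det2 (A (i - 1)) (A i) ∧
      0 ≤ det2 (A (i - 1)) p * det2 (A (i - 1)) (A i))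
    (c : ℕ × ℕ → ℝ)
    (horth : ∀ i, ∀ e M, e ≤ M → M < n →
      ∑ k ∈ range (n + 1), radMoment (k + M) * angMoment c k (A (i - 1)) (A i) (X ^ e) = 0) :
    ∀ k ≤ n, ∀ m ∈ antidiagonal k, c m = 0 := by
  intro k
  induction k using Nat.strong_induction_on with
  | _ k ih =>
  intro hkn
  rcases Nat.eq_zero_or_pos k with rfl | hk
  · suffices c (0, 0) = 0 by simpa using this
    by_contra hc0
    have hrad (i : ZMod q) := radialPoly_orthogonal n c _ _ (horth i) 1 0 (by simp)
    simp only [pow_zero, one_mul] at hrad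
    have hcoef (i : ZMod q) :
        (dot2 (c (1, 0), c (0, 1)) (A (i - 1)) + dot2 (c (1, 0), c (0, 1)) (A i)) / 12 =
        (radialPoly n c (A (i - 1)) (A i) 1).coeff 1 := by
      rw [coeff_radialPoly, if_pos hn, angMoment_one_one]
    have hcoef0 (i : ZMod q) : c (0, 0) / 6 = (radialPoly n c (A (i - 1)) (A i) 1).coeff 0 := by
      rw [coeff_radialPoly, if_pos n.zero_le, angMoment_zero_one]
    by_cases hg : ((c (1, 0), c (0, 1)) : ℝ × ℝ) = 0
    · have := radial_eq_zero_of_deriv _ n hn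
        (natDegree_radialPoly_le n c (A (0 - 1)) (A 0) 1) (by
          rw [← hcoef, hg]; simp [dot2]) (hrad 0)
      have h0 := hcoef0 0
      rw [this, coeff_zero] at h0
      exact hc0 (by linarith)
    · have heq (i : ZMod q) : radialPoly n c (A (i - 1)) (A i) 1 -
          radialPoly n c (A (0 - 1)) (A 0) 1 = 0 := by
        set h := radialPoly n c (A (i - 1)) (A i) 1 - radialPoly n c (A (0 - 1)) (A 0) 1 with hh
        obtain ⟨g, hg⟩ : X ∣ h := by
          rw [X_dvd_iff, hh, coeff_sub, ← hcoef0, ← hcoef0, sub_self]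
        have hd : h.natDegree ≤ n :=
          (natDegree_sub_le _ _).trans (max_le (natDegree_radialPoly_le n c _ _ 1)
            (natDegree_radialPoly_le n c _ _ 1))
        by_cases hg0 : g = 0
        · rw [hg, hg0, mul_zero]
        have hgd : g.natDegree < n := by
          rw [hg, natDegree_mul X_ne_zero hg0, natDegree_X] at hd
          omega
        refine radial_eq_zero_of_orthogonal h g 0 (by simpa using hg) ?_
        rw [pow_zero, one_mul]
        have h1 := hrad i g hgd
        have h2 := hrad 0 g hgd
        have h3 : ∫ x in (0 : ℝ)..1, (h * g).eval x * (x ^ 3 * (1 - x)) =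
            (∫ x in (0 : ℝ)..1, (radialPoly n c (A (i - 1)) (A i) 1 * g).eval x *
              (x ^ 3 * (1 - x))) -
            ∫ x in (0 : ℝ)..1, (radialPoly n c (A (0 - 1)) (A 0) 1 * g).eval x *
              (x ^ 3 * (1 - x)) := by
          rw [← intervalIntegral.integral_sub]
          · congr 1; ext x
            rw [hh]; simp only [eval_mul, eval_sub]; ring
          · exact Continuous.intervalIntegrable (by fun_prop) _ _
          · exact Continuous.intervalIntegrable (by fun_prop) _ _
        rw [h3, h1, h2, sub_zero]
      refine false_of_constant_consecutive_sum hq A hdet hdisj hcov _ hg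
        (12 * (radialPoly n c (A (0 - 1)) (A 0) 1).coeff 1) fun i => ?_
      have := hcoef i
      rw [sub_eq_zero.1 (heq i)] at this
      rw [← this, mul_div_cancel₀ _ (by norm_num)]
  · have hline (j : ℕ) (hj : j < k) (a b : ℝ × ℝ) : linePoly c j a b = 0 :=
      Finset.sum_eq_zero fun m hm => by rw [ih j hj (by omega) m hm, map_zero, zero_mul]
    have hZ (i : ZMod q) := exists_roots_of_orthogonal
      (linePoly c k (A (i - 1) - A i) (A i)) k (fun x => x * (1 - x)) (by fun_prop)
      (fun x hx => mul_pos hx.1 (sub_pos.2 hx.2)) (fun p hp => by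
        change angMoment c k (A (i - 1)) (A i) p = 0
        have h := radialPoly_eq_zero n c _ _ (horth i) p (k - 1) (by omega) (fun j hj => by
          rw [angMoment, hline j (by omega)]; simp)
        have := coeff_radialPoly n c (A (i - 1)) (A i) p k
        rw [h, if_pos hkn, coeff_zero] at this
        exact this.symm)
    choose Z hcard hroot using hZ
    refine coeff_eq_zero_of_roots (ι := ZMod q) (by rwa [ZMod.card])
      (fun i => A (i - 1)) A hdet hdisj c k hk Z hcard fun i z hz => ?_
    obtain ⟨h1, h2⟩ := hroot i z hz
    refine ⟨h1, ?_⟩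
    rw [eval_linePoly] at h2
    rw [← h2]
    congr 1
    module

/-- The polynomial of degree at most `n` with coefficients `c`. -/
def polyForm (n : ℕ) (c : ℕ × ℕ → ℝ) (p : ℝ × ℝ) : ℝ :=
  ∑ k ∈ range (n + 1), homForm c k p

/-- Polar-type parametrization of the triangle `0, a, b` by the unit square. -/
def duffy (a b x : ℝ × ℝ) : ℝ × ℝ := x.1 • (x.2 • a + (1 - x.2) • b)

/-- The closed unit square. -/
def unitSq : Set (ℝ × ℝ) := Set.Icc (0 : ℝ) 1 ×ˢ Set.Icc (0 : ℝ) 1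

/-- The bubble weight, times the Jacobian, in the coordinates of `duffy`. -/
def duffyWeight (x : ℝ × ℝ) : ℝ := x.1 ^ 3 * (1 - x.1) * (x.2 * (1 - x.2))

/-- Moments of a polynomial over the triangle `0, a, b`. -/
def triMoment (n : ℕ) (c : ℕ × ℕ → ℝ) (a b : ℝ × ℝ) (j : ℕ × ℕ) : ℝ :=
  ∫ x in unitSq, polyForm n c (duffy a b x) * (x.1 ^ (j.1 + j.2) * x.2 ^ j.1) * duffyWeight x

/-- `L²` mass over the triangle `0, a, b`, up to the Jacobian determinant. -/
def triMass (n : ℕ) (c : ℕ × ℕ → ℝ) (a b : ℝ × ℝ) : ℝ :=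
  ∫ x in unitSq, x.1 * polyForm n c (duffy a b x) ^ 2

/-- Exponents of monomials of degree less than `n`. -/
def lowExps (n : ℕ) : Finset (ℕ × ℕ) := (range n ×ˢ range n).filter fun j => j.1 + j.2 < n

lemma mem_lowExps {n : ℕ} {j : ℕ × ℕ} : j ∈ lowExps n ↔ j.1 + j.2 < n := by
  simp only [lowExps, Finset.mem_filter, Finset.mem_product, Finset.mem_range]
  omega

/-- Sum of the squared moments over a patch. -/
def patchMoments {q : ℕ} [NeZero q] (n : ℕ) (A : ZMod q → ℝ × ℝ) (c : ℕ × ℕ → ℝ) : ℝ :=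
  ∑ i, ∑ j ∈ lowExps n, triMoment n c (A (i - 1)) (A i) j ^ 2

/-- `L²` mass over a patch. -/
def patchMass {q : ℕ} [NeZero q] (n : ℕ) (A : ZMod q → ℝ × ℝ) (c : ℕ × ℕ → ℝ) : ℝ :=
  ∑ i, |det2 (A (i - 1)) (A i)| * triMass n c (A (i - 1)) (A i)

/-- Normalized vertex families whose cones are nondegenerate, disjoint and cover the plane. -/
def fanSet (q : ℕ) (R d : ℝ) : Set (ZMod q → ℝ × ℝ) :=
  {A | (∀ i, ‖A i‖ ≤ R) ∧ (∀ i, d ≤ |det2 (A (i - 1)) (A i)|) ∧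
    (∀ i j p, i ≠ j → InCone (A (i - 1)) (A i) p → ¬ InCone (A (j - 1)) (A j) p) ∧
    ∀ p, ∃ i, 0 ≤ det2 p (A i) * det2 (A (i - 1)) (A i) ∧
      0 ≤ det2 (A (i - 1)) p * det2 (A (i - 1)) (A i)}

lemma isCompact_unitSq : IsCompact unitSq := isCompact_Icc.prod isCompact_Icc

lemma polyForm_duffy (n : ℕ) (c : ℕ × ℕ → ℝ) (a b x : ℝ × ℝ) :
    polyForm n c (duffy a b x) =
      ∑ k ∈ range (n + 1), x.1 ^ k * (linePoly c k (a - b) b).eval x.2 := by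
  refine Finset.sum_congr rfl fun k _ => ?_
  rw [duffy, homForm_smul, eval_linePoly]
  congr 2
  module

open Polynomial in
lemma triMoment_eq (n : ℕ) (c : ℕ × ℕ → ℝ) (a b : ℝ × ℝ) (j : ℕ × ℕ) :
    triMoment n c a b j = ∑ k ∈ range (n + 1),
      radMoment (k + (j.1 + j.2)) * angMoment c k a b (X ^ j.1) := by
  have hI (f : ℝ → ℝ) : ∫ x in Set.Icc (0 : ℝ) 1, f x = ∫ x in (0 : ℝ)..1, f x := by
    rw [integral_Icc_eq_integral_Ioc, intervalIntegral.integral_of_le zero_le_one]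
  have h1 (k : ℕ) : ∫ x in unitSq, (x.1 ^ (k + (j.1 + j.2)) * (x.1 ^ 3 * (1 - x.1))) *
      ((linePoly c k (a - b) b * X ^ j.1).eval x.2 * (x.2 * (1 - x.2))) =
      radMoment (k + (j.1 + j.2)) * angMoment c k a b (X ^ j.1) := by
    rw [unitSq, Measure.volume_eq_prod]
    refine (setIntegral_prod_mul (μ := volume) (ν := volume)
      (fun r : ℝ => r ^ (k + (j.1 + j.2)) * (r ^ 3 * (1 - r)))
      (fun s : ℝ => (linePoly c k (a - b) b * X ^ j.1).eval s * (s * (1 - s))) _ _).trans ?_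
    rw [hI, hI]; rfl
  simp_rw [← h1]
  rw [← integral_finsetSum]
  · rw [triMoment]
    congr 1; ext x
    rw [polyForm_duffy, duffyWeight]
    simp only [Finset.sum_mul, eval_mul, eval_pow, eval_X]
    exact Finset.sum_congr rfl fun _ _ => by ring
  · intro k _
    refine ContinuousOn.integrableOn_compact isCompact_unitSq (Continuous.continuousOn ?_)
    fun_prop

lemma patchMoments_eq_zero {q : ℕ} [NeZero q] (hq : 3 ≤ q) (n : ℕ) (hn : 1 ≤ n) {R d : ℝ}
    (hd : 0 < d) {A : ZMod q → ℝ × ℝ} (hA : A ∈ fanSet q R d) (c : ℕ × ℕ → ℝ)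
    (h : patchMoments n A c = 0) : ∀ k ≤ n, ∀ m ∈ antidiagonal k, c m = 0 := by
  obtain ⟨-, hdet, hdisj, hcov⟩ := hA
  refine coeff_eq_zero_of_patch_orthogonal hq n hn A
    (fun i => abs_pos.1 (hd.trans_le (hdet i))) hdisj hcov c fun i e M heM hM => ?_
  rw [patchMoments, Finset.sum_eq_zero_iff_of_nonneg
    (fun i _ => Finset.sum_nonneg fun j _ => sq_nonneg _)] at h
  have h1 := h i (Finset.mem_univ i)
  rw [Finset.sum_eq_zero_iff_of_nonneg (fun j _ => sq_nonneg _)] at h1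
  have h2 := h1 (e, M - e) (mem_lowExps.2 (by simp only; omega))
  rw [sq_eq_zero_iff, triMoment_eq] at h2
  simpa only [Nat.add_sub_cancel' heM] using h2

lemma isCompact_fanSet (q : ℕ) [NeZero q] (R d : ℝ) : IsCompact (fanSet q R d) := by
  refine (isCompact_closedBall (0 : ZMod q → ℝ × ℝ) (max R 0)).of_isClosed_subset ?_ ?_
  · have hdet (i : ZMod q) : Continuous fun A : ZMod q → ℝ × ℝ => det2 (A (i - 1)) (A i) := by
      unfold det2; fun_prop
    have hl (i : ZMod q) (p : ℝ × ℝ) : Continuous fun A : ZMod q → ℝ × ℝ => det2 p (A i) := by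
      unfold det2; fun_prop
    have hr (i : ZMod q) (p : ℝ × ℝ) :
        Continuous fun A : ZMod q → ℝ × ℝ => det2 (A (i - 1)) p := by
      unfold det2; fun_prop
    have hopen (i : ZMod q) (p : ℝ × ℝ) :
        IsOpen {A : ZMod q → ℝ × ℝ | InCone (A (i - 1)) (A i) p} :=
      (isOpen_lt continuous_const ((hl i p).mul (hdet i))).inter
        (isOpen_lt continuous_const ((hr i p).mul (hdet i)))
    unfold fanSet
    refine IsClosed.and ?_ (IsClosed.and ?_ (IsClosed.and ?_ ?_))
    · simp only [Set.ofPred_forall]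
      exact isClosed_iInter fun i => isClosed_le (continuous_apply i).norm continuous_const
    · simp only [Set.ofPred_forall]
      exact isClosed_iInter fun i => isClosed_le continuous_const (hdet i).abs
    · simp only [Set.ofPred_forall]
      refine isClosed_iInter fun i => isClosed_iInter fun j => isClosed_iInter fun p =>
        isClosed_iInter fun _ => ?_
      have h := ((hopen i p).inter (hopen j p)).isClosed_compl
      have h' : ({A : ZMod q → ℝ × ℝ | InCone (A (i - 1)) (A i) p} ∩
          {A : ZMod q → ℝ × ℝ | InCone (A (j - 1)) (A j) p})ᶜ = {A : ZMod q → ℝ × ℝ |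
          InCone (A (i - 1)) (A i) p → ¬ InCone (A (j - 1)) (A j) p} :=
        Set.ext fun A => not_and
      rwa [h'] at h
    · simp only [Set.ofPred_forall, Set.ofPred_exists]
      exact isClosed_iInter fun p => isClosed_iUnion_of_finite fun i =>
        (isClosed_le continuous_const ((hl i p).mul (hdet i))).inter
          (isClosed_le continuous_const ((hr i p).mul (hdet i)))
  · intro A hA
    rw [mem_closedBall_zero_iff, pi_norm_le_iff_of_nonneg (le_max_right _ _)]
    exact fun i => (hA.1 i).trans (le_max_left _ _)

/-- Extension by zero of a coefficient vector. -/
def extendCoeff {n : ℕ} (y : lowExps (n + 1) → ℝ) (m : ℕ × ℕ) : ℝ :=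
  if h : m ∈ lowExps (n + 1) then y ⟨m, h⟩ else 0

lemma polyForm_congr {n : ℕ} {c c' : ℕ × ℕ → ℝ} (h : ∀ m ∈ lowExps (n + 1), c m = c' m)
    (p : ℝ × ℝ) : polyForm n c p = polyForm n c' p := by
  refine Finset.sum_congr rfl fun k hk => Finset.sum_congr rfl fun m hm => ?_
  rw [h m (mem_lowExps.2 _)]
  rw [HasAntidiagonal.mem_antidiagonal] at hm
  rw [hm]
  exact Finset.mem_range.1 hk

lemma polyForm_smul (n : ℕ) (t : ℝ) (c : ℕ × ℕ → ℝ) (p : ℝ × ℝ) :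
    polyForm n (t • c) p = t * polyForm n c p := by
  simp only [polyForm, homForm, Finset.mul_sum, Pi.smul_apply, smul_eq_mul, mul_assoc]

lemma patchMoments_congr {q : ℕ} [NeZero q] {n : ℕ} (A : ZMod q → ℝ × ℝ) {c c' : ℕ × ℕ → ℝ}
    (h : ∀ m ∈ lowExps (n + 1), c m = c' m) : patchMoments n A c = patchMoments n A c' := by
  simp only [patchMoments, triMoment, polyForm_congr h]

lemma patchMass_congr {q : ℕ} [NeZero q] {n : ℕ} (A : ZMod q → ℝ × ℝ) {c c' : ℕ × ℕ → ℝ}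
    (h : ∀ m ∈ lowExps (n + 1), c m = c' m) : patchMass n A c = patchMass n A c' := by
  simp only [patchMass, triMass, polyForm_congr h]

lemma patchMoments_smul {q : ℕ} [NeZero q] (n : ℕ) (A : ZMod q → ℝ × ℝ) (t : ℝ)
    (c : ℕ × ℕ → ℝ) : patchMoments n A (t • c) = t ^ 2 * patchMoments n A c := by
  simp only [patchMoments, triMoment, polyForm_smul, Finset.mul_sum, mul_assoc,
    integral_const_mul, mul_pow]

lemma patchMass_smul {q : ℕ} [NeZero q] (n : ℕ) (A : ZMod q → ℝ × ℝ) (t : ℝ)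
    (c : ℕ × ℕ → ℝ) : patchMass n A (t • c) = t ^ 2 * patchMass n A c := by
  simp only [patchMass, triMass, polyForm_smul, Finset.mul_sum, mul_pow, mul_left_comm _ (t ^ 2),
    integral_const_mul]

lemma continuous_extendCoeff {n : ℕ} (m : ℕ × ℕ) :
    Continuous fun y : lowExps (n + 1) → ℝ => extendCoeff y m := by
  unfold extendCoeff
  split_ifs <;> fun_prop

lemma continuous_polyForm_duffy {q : ℕ} (n : ℕ) (i : ZMod q) :
    Continuous fun z : ((ZMod q → ℝ × ℝ) × (lowExps (n + 1) → ℝ)) × (ℝ × ℝ) =>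
      polyForm n (extendCoeff z.1.2) (duffy (z.1.1 (i - 1)) (z.1.1 i) z.2) := by
  have (m : ℕ × ℕ) : Continuous fun z : ((ZMod q → ℝ × ℝ) × (lowExps (n + 1) → ℝ)) × (ℝ × ℝ) =>
      extendCoeff z.1.2 m := (continuous_extendCoeff m).comp (by fun_prop)
  unfold polyForm homForm duffy
  fun_prop

lemma continuous_patchMoments {q : ℕ} [NeZero q] (n : ℕ) :
    Continuous fun z : (ZMod q → ℝ × ℝ) × (lowExps (n + 1) → ℝ) =>
      patchMoments n z.1 (extendCoeff z.2) := by
  unfold patchMoments triMoment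
  refine continuous_finsetSum _ fun i _ => continuous_finsetSum _ fun j _ => Continuous.pow ?_ 2
  refine continuous_parametric_integral_of_continuous ?_ isCompact_unitSq
  have := continuous_polyForm_duffy (q := q) n i
  unfold Function.uncurry duffyWeight
  fun_prop

lemma continuous_patchMass {q : ℕ} [NeZero q] (n : ℕ) :
    Continuous fun z : (ZMod q → ℝ × ℝ) × (lowExps (n + 1) → ℝ) =>
      patchMass n z.1 (extendCoeff z.2) := by
  unfold patchMass triMass
  refine continuous_finsetSum _ fun i _ => Continuous.mul (by unfold det2; fun_prop) ?_
  refine continuous_parametric_integral_of_continuous ?_ isCompact_unitSq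
  have := continuous_polyForm_duffy (q := q) n i
  unfold Function.uncurry
  fun_prop

lemma exists_patchMass_le {q : ℕ} [NeZero q] (hq : 3 ≤ q) (n : ℕ) (hn : 1 ≤ n) (R : ℝ) {d : ℝ}
    (hd : 0 < d) :
    ∃ C > 0, ∀ A ∈ fanSet q R d, ∀ c, patchMass n A c ≤ C * patchMoments n A c := by
  have hnn (A : ZMod q → ℝ × ℝ) (c) : 0 ≤ patchMoments n A c :=
    Finset.sum_nonneg fun i _ => Finset.sum_nonneg fun j _ => sq_nonneg _
  have hpos : ∀ z ∈ fanSet q R d ×ˢ Metric.sphere (0 : lowExps (n + 1) → ℝ) 1,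
      0 < patchMoments n z.1 (extendCoeff z.2) := by
    rintro ⟨A, y⟩ ⟨hA, hy⟩
    refine (hnn _ _).lt_of_ne' fun h => ?_
    have h0 := patchMoments_eq_zero hq n hn hd hA _ h
    have : y = 0 := by
      ext ⟨m, hm⟩
      have := h0 (m.1 + m.2) (Nat.lt_succ_iff.1 (mem_lowExps.1 hm)) m
        (HasAntidiagonal.mem_antidiagonal.2 rfl)
      simpa [extendCoeff, hm] using this
    simp [this] at hy
  obtain ⟨C, hC⟩ := ((isCompact_fanSet q R d).prod (isCompact_sphere
    (0 : lowExps (n + 1) → ℝ) 1)).bddAbove_image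
      ((continuous_patchMass (q := q) n).continuousOn.div
        (continuous_patchMoments n).continuousOn fun z hz => (hpos z hz).ne')
  refine ⟨max C 1, by positivity, fun A hA c => ?_⟩
  let y : lowExps (n + 1) → ℝ := fun m => c m
  have hcy : ∀ m ∈ lowExps (n + 1), c m = extendCoeff y m := fun m hm => by
    simp [extendCoeff, hm, y]
  rw [patchMass_congr A hcy, patchMoments_congr A hcy]
  by_cases hy : y = 0
  · have h0 : extendCoeff y = (0 : ℝ) • extendCoeff y := by
      ext m; simp [hy, extendCoeff]
    rw [h0, patchMass_smul, patchMoments_smul]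
    simp
  · have hy' : 0 < ‖y‖ := norm_pos_iff.2 hy
    have h0 : extendCoeff y = ‖y‖ • extendCoeff (‖y‖⁻¹ • y) := by
      ext m
      by_cases hm : m ∈ lowExps (n + 1) <;> simp [extendCoeff, hm, hy'.ne']
    have hmem : (A, ‖y‖⁻¹ • y) ∈ fanSet q R d ×ˢ Metric.sphere (0 : lowExps (n + 1) → ℝ) 1 :=
      ⟨hA, by simp [norm_smul, hy'.ne']⟩
    have hle := hC ⟨_, hmem, rfl⟩
    rw [Pi.div_apply, div_le_iff₀ (hpos _ hmem)] at hle
    rw [h0, patchMass_smul, patchMoments_smul, mul_left_comm]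
    refine mul_le_mul_of_nonneg_left (hle.trans ?_) (sq_nonneg _)
    exact mul_le_mul_of_nonneg_right (le_max_left _ _) (hnn _ _)

lemma det2_ne_zero_of_affineIndependent {a b : ℝ × ℝ} (h : AffineIndependent ℝ ![0, a, b]) :
    det2 a b ≠ 0 := by
  intro hD
  rw [affineIndependent_iff] at h
  have key (s t : ℝ) (hst : s • a + t • b = 0) : s = 0 ∧ t = 0 := by
    have := h Finset.univ ![-s - t, s, t] (by simp [Fin.sum_univ_three]; ring)
      (by simpa [Fin.sum_univ_three] using hst)
    exact ⟨this 1 (Finset.mem_univ _), this 2 (Finset.mem_univ _)⟩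
  unfold det2 at hD
  obtain ⟨h1, h2⟩ := key b.1 (-a.1) (by ext <;> simp <;> linarith)
  obtain ⟨h3, h4⟩ := key b.2 (-a.2) (by ext <;> simp <;> linarith)
  obtain ⟨h5, -⟩ := key 1 1 (by ext <;> simp <;> linarith)
  exact one_ne_zero h5

lemma affineIndependent_of_det2_ne_zero {a b : ℝ × ℝ} (h : det2 a b ≠ 0) :
    AffineIndependent ℝ ![0, a, b] := by
  rw [affineIndependent_iff_of_fintype]
  intro w hw h0
  rw [Finset.weightedVSub_eq_linear_combination _ hw] at h0
  simp only [Fin.sum_univ_three, Matrix.cons_val] at hw h0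
  have e1 := congrArg Prod.fst h0
  have e2 := congrArg Prod.snd h0
  simp at e1 e2
  have h1 : w 1 * det2 a b = 0 := by
    unfold det2; linear_combination b.2 * e1 - b.1 * e2
  have h2 : w 2 * det2 a b = 0 := by
    unfold det2; linear_combination -a.2 * e1 + a.1 * e2
  have h1' := (mul_eq_zero.1 h1).resolve_right h
  have h2' := (mul_eq_zero.1 h2).resolve_right h
  have h0' : w 0 = 0 := by linarith
  intro i
  fin_cases i <;> assumption

lemma mem_convexHull_zero {a b : ℝ × ℝ} (p : ℝ × ℝ) :
    p ∈ convexHull ℝ {0, a, b} ↔ ∃ s t : ℝ, 0 ≤ s ∧ 0 ≤ t ∧ s + t ≤ 1 ∧ p = s • a + t • b := by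
  rw [convexHull_insert ⟨a, by simp⟩, convexHull_pair, mem_convexJoin]
  constructor
  · rintro ⟨x, rfl, y, ⟨u, v, hu, hv, huv, rfl⟩, ⟨c, d, hc, hd, hcd, rfl⟩⟩
    refine ⟨d * u, d * v, by positivity, by positivity, ?_, by simp; module⟩
    rw [← mul_add, huv]; linarith
  · rintro ⟨s, t, hs, ht, hst, rfl⟩
    rcases (add_nonneg hs ht).eq_or_lt with h | h
    · obtain ⟨rfl, rfl⟩ : s = 0 ∧ t = 0 := ⟨by linarith, by linarith⟩
      exact ⟨0, rfl, a, left_mem_segment _ _ _, by simpa using left_mem_segment _ _ _⟩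
    · refine ⟨0, rfl, (s / (s + t)) • a + (t / (s + t)) • b, ⟨_, _, by positivity, by positivity,
        by field_simp, rfl⟩, ⟨1 - (s + t), s + t, by linarith, h.le, by ring, ?_⟩⟩
      rw [smul_zero, zero_add, smul_add, smul_smul, smul_smul]
      congr 2 <;> field_simp

lemma det2_comb_left (a b : ℝ × ℝ) (s t : ℝ) : det2 (s • a + t • b) b = s * det2 a b := by
  simp [det2]; ring

lemma det2_comb_right (a b : ℝ × ℝ) (s t : ℝ) : det2 a (s • a + t • b) = t * det2 a b := by
  simp [det2]; ring

lemma eq_comb {a b : ℝ × ℝ} (h : det2 a b ≠ 0) (p : ℝ × ℝ) :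
    p = (det2 p b / det2 a b) • a + (det2 a p / det2 a b) • b := by
  ext <;> simp <;> field_simp <;> simp [det2] <;> ring

lemma mem_tri_zero {a b : ℝ × ℝ} (h : det2 a b ≠ 0) (p : ℝ × ℝ) :
    p ∈ tri 0 a b ↔ ∃ s t : ℝ, 0 < s ∧ 0 < t ∧ s + t < 1 ∧ p = s • a + t • b := by
  have hs : Continuous fun p : ℝ × ℝ => det2 p b / det2 a b := by unfold det2; fun_prop
  have ht : Continuous fun p : ℝ × ℝ => det2 a p / det2 a b := by unfold det2; fun_prop
  constructor
  · intro hp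
    have key (v : ℝ × ℝ) : ∃ ε > (0 : ℝ), p + ε • v ∈ convexHull ℝ {0, a, b} := by
      have hc : Filter.Tendsto (fun ε : ℝ => p + ε • v) (nhdsWithin 0 (Set.Ioi 0)) (nhds p) := by
        have : Continuous fun ε : ℝ => p + ε • v := by fun_prop
        simpa using (this.tendsto 0).mono_left nhdsWithin_le_nhds
      obtain ⟨ε, h1, h2⟩ := ((hc.eventually (mem_interior_iff_mem_nhds.1 hp)).and
        self_mem_nhdsWithin).exists
      exact ⟨ε, h2, h1⟩
    have hcoef {s t s' t' : ℝ} (h' : s • a + t • b = s' • a + t' • b) : s = s' ∧ t = t' := by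
      constructor
      · have := congrArg (det2 · b) h'
        simpa [det2_comb_left, h] using this
      · have := congrArg (det2 a ·) h'
        simpa [det2_comb_right, h] using this
    obtain ⟨s, t, hp'⟩ : ∃ s t : ℝ, p = s • a + t • b := ⟨_, _, eq_comb h p⟩
    refine ⟨s, t, ?_, ?_, ?_, hp'⟩
    · obtain ⟨ε, hε, h1⟩ := key (-a)
      obtain ⟨s', t', hs', -, -, he⟩ := (mem_convexHull_zero _).1 h1
      have := (hcoef (s := s - ε) (t := t) (Eq.trans (by rw [hp']; module) he)).1
      linarith
    · obtain ⟨ε, hε, h1⟩ := key (-b)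
      obtain ⟨s', t', -, ht', -, he⟩ := (mem_convexHull_zero _).1 h1
      have := (hcoef (s := s) (t := t - ε) (Eq.trans (by rw [hp']; module) he)).2
      linarith
    · obtain ⟨ε, hε, h1⟩ := key a
      obtain ⟨s', t', -, -, hst, he⟩ := (mem_convexHull_zero _).1 h1
      have := hcoef (s := s + ε) (t := t) (Eq.trans (by rw [hp']; module) he)
      linarith
  · rintro ⟨s, t, hs0, ht0, hst, rfl⟩
    rw [tri, mem_interior]
    refine ⟨{p | 0 < det2 p b / det2 a b} ∩ {p | 0 < det2 a p / det2 a b} ∩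
      {p | det2 p b / det2 a b + det2 a p / det2 a b < 1}, fun p hp => ?_,
      ((isOpen_lt continuous_const hs).inter (isOpen_lt continuous_const ht)).inter
        (isOpen_lt (hs.add ht) continuous_const), ?_⟩
    · exact (mem_convexHull_zero p).2 ⟨_, _, hp.1.1.le, hp.1.2.le, hp.2.le, eq_comb h p⟩
    · simp only [Set.mem_inter_iff, Set.mem_ofPred_eq, det2_comb_left, det2_comb_right,
        mul_div_cancel_right₀ _ h]
      exact ⟨⟨hs0, ht0⟩, hst⟩

lemma bubble_comb {a b : ℝ × ℝ} (h : det2 a b ≠ 0) (s t : ℝ) :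
    bubble 0 a b (s • a + t • b) = (1 - s - t) * s * t := by
  have h1 : bary 0 a b (s • a + t • b) = 1 - s - t := by
    rw [bary, div_eq_iff]
    · simp [det2]; ring
    · convert neg_ne_zero.2 h using 1
      simp [det2]; ring
  have h2 : bary a b 0 (s • a + t • b) = s := by
    rw [bary, div_eq_iff]
    · simp [det2]; ring
    · convert neg_ne_zero.2 h using 1
      simp [det2]; ring
  have h3 : bary b 0 a (s • a + t • b) = t := by
    rw [bary, div_eq_iff]
    · simp [det2]; ring
    · convert neg_ne_zero.2 h using 1
      simp [det2]; ring
  rw [bubble, h1, h2, h3]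

/-- The open unit square. -/
def openSq : Set (ℝ × ℝ) := Set.Ioo (0 : ℝ) 1 ×ˢ Set.Ioo (0 : ℝ) 1

lemma duffy_eq (a b x : ℝ × ℝ) :
    duffy a b x = (x.1 * x.2) • a + (x.1 * (1 - x.2)) • b := by
  rw [duffy]; module

lemma duffy_image {a b : ℝ × ℝ} (h : det2 a b ≠ 0) : duffy a b '' openSq = tri 0 a b := by
  ext p
  rw [mem_tri_zero h]
  constructor
  · rintro ⟨x, ⟨⟨h1, h2⟩, h3, h4⟩, rfl⟩
    refine ⟨x.1 * x.2, x.1 * (1 - x.2), mul_pos h1 h3, mul_pos h1 (by linarith), ?_,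
      duffy_eq a b x⟩
    linarith
  · rintro ⟨s, t, hs, ht, hst, rfl⟩
    have hp : 0 < s + t := add_pos hs ht
    refine ⟨(s + t, s / (s + t)), ⟨⟨hp, hst⟩, by positivity, ?_⟩, ?_⟩
    · simp only; rw [div_lt_one hp]; linarith
    · rw [duffy_eq]
      congr 2
      · field_simp
      · field_simp
        ring

lemma duffy_injOn {a b : ℝ × ℝ} (h : det2 a b ≠ 0) : Set.InjOn (duffy a b) openSq := by
  rintro x ⟨⟨h1, -⟩, -⟩ y - hxy
  rw [duffy_eq, duffy_eq] at hxy
  have e1 := congrArg (det2 · b) hxy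
  have e2 := congrArg (det2 a ·) hxy
  simp only [det2_comb_left, det2_comb_right, mul_left_inj' h] at e1 e2
  have e3 : x.1 = y.1 := by linarith
  refine Prod.ext e3 (mul_left_cancel₀ h1.ne' ?_)
  rw [e1, e3]

lemma unitSq_ae_eq : unitSq =ᵐ[volume] openSq := by
  rw [unitSq, openSq, Measure.volume_eq_prod]
  exact (Measure.set_prod_ae_eq Ioo_ae_eq_Icc Ioo_ae_eq_Icc).symm

/-- The derivative of `duffy a b` at `x`. -/
def duffyDeriv (a b x : ℝ × ℝ) : ℝ × ℝ →L[ℝ] ℝ × ℝ :=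
  (ContinuousLinearMap.fst ℝ ℝ ℝ).smulRight (x.2 • a + (1 - x.2) • b) +
    (ContinuousLinearMap.snd ℝ ℝ ℝ).smulRight (x.1 • (a - b))

lemma hasFDerivAt_duffy (a b x : ℝ × ℝ) : HasFDerivAt (duffy a b) (duffyDeriv a b x) x := by
  have h1 : HasFDerivAt (fun x : ℝ × ℝ => x.1) (ContinuousLinearMap.fst ℝ ℝ ℝ) x :=
    hasFDerivAt_fst
  have h2 : HasFDerivAt (fun x : ℝ × ℝ => x.2) (ContinuousLinearMap.snd ℝ ℝ ℝ) x :=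
    hasFDerivAt_snd
  have h3 := h1.smul ((h2.smul_const a).add ((h2.const_sub 1).smul_const b))
  exact (show HasFDerivAt (duffy a b) _ x from h3).congr_fderiv
    (by ext <;> simp [duffyDeriv] <;> ring)

lemma det_duffyDeriv (a b x : ℝ × ℝ) : (duffyDeriv a b x).det = -(x.1 * det2 a b) := by
  rw [ContinuousLinearMap.det, ← LinearMap.det_toMatrix (Module.Basis.finTwoProd ℝ),
    Matrix.det_fin_two]
  simp [LinearMap.toMatrix_apply, duffyDeriv, det2]
  ring

lemma integral_tri {a b : ℝ × ℝ} (h : det2 a b ≠ 0) (f : ℝ × ℝ → ℝ) :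
    ∫ p in tri 0 a b, f p = |det2 a b| * ∫ x in unitSq, x.1 * f (duffy a b x) := by
  rw [← duffy_image h, integral_image_eq_integral_abs_det_fderiv_smul volume
    (measurableSet_Ioo.prod measurableSet_Ioo)
    (fun x _ => (hasFDerivAt_duffy a b x).hasFDerivWithinAt) (duffy_injOn h),
    setIntegral_congr_set unitSq_ae_eq, ← integral_const_mul]
  refine setIntegral_congr_fun (measurableSet_Ioo.prod measurableSet_Ioo) fun x hx => ?_
  rw [det_duffyDeriv, abs_neg, abs_mul, abs_of_pos hx.1.1, smul_eq_mul]
  ring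

/-- Coefficients of a bivariate polynomial, indexed by pairs of exponents. -/
def mvCoeff (v : MvPolynomial (Fin 2) ℝ) (m : ℕ × ℕ) : ℝ :=
  v.coeff (Finsupp.single 0 m.1 + Finsupp.single 1 m.2)

lemma evalP_eq_polyForm {n : ℕ} {v : MvPolynomial (Fin 2) ℝ} (hv : v.totalDegree ≤ n)
    (p : ℝ × ℝ) : evalP v p = polyForm n (mvCoeff v) p := by
  have hd (d : Fin 2 →₀ ℕ) : Finsupp.single 0 (d 0) + Finsupp.single 1 (d 1) = d := by
    ext i; fin_cases i <;> simp
  rw [evalP, MvPolynomial.eval_eq', polyForm]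
  simp only [homForm]
  rw [Finset.sum_sigma']
  refine Finset.sum_of_injOn (fun d => ⟨d 0 + d 1, (d 0, d 1)⟩) ?_ ?_ ?_ ?_
  · intro d _ d' _ h
    simp only [Sigma.mk.injEq] at h
    obtain ⟨h1, h2⟩ := h
    have h3 := Prod.mk.inj (eq_of_heq h2)
    rw [← hd d, ← hd d', h3.1, h3.2]
  · intro d hd
    have := (MvPolynomial.le_totalDegree hd).trans hv
    rw [Finsupp.sum_fintype _ _ (fun _ => rfl), Fin.sum_univ_two] at this
    simp only [Finset.coe_sigma, Set.mem_sigma_iff, Finset.mem_coe, Finset.mem_range,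
      HasAntidiagonal.mem_antidiagonal, and_true]
    omega
  · rintro ⟨k, m⟩ hm hm'
    simp only [Finset.mem_sigma, HasAntidiagonal.mem_antidiagonal] at hm
    rw [mul_eq_zero, or_iff_not_imp_right]
    intro _
    by_contra h
    refine hm' ⟨Finsupp.single 0 m.1 + Finsupp.single 1 m.2, MvPolynomial.mem_support_iff.2 h, ?_⟩
    simp [hm.2]
  · intro d _
    simp [mvCoeff, hd, Fin.prod_univ_two]

lemma continuous_evalP (v : MvPolynomial (Fin 2) ℝ) : Continuous (evalP v) :=
  v.continuous_eval.comp (by fun_prop)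

lemma continuous_duffy (a b : ℝ × ℝ) : Continuous (duffy a b) := by
  unfold duffy; fun_prop

lemma duffyWeight_nonneg {x : ℝ × ℝ} (hx : x ∈ unitSq) : 0 ≤ duffyWeight x := by
  obtain ⟨⟨h1, h2⟩, h3, h4⟩ := hx
  have : 0 ≤ 1 - x.1 := by linarith
  have : 0 ≤ 1 - x.2 := by linarith
  unfold duffyWeight
  positivity

lemma innerT_eq {a b : ℝ × ℝ} (h : det2 a b ≠ 0) (u v : MvPolynomial (Fin 2) ℝ) :
    innerT 0 a b u v = |det2 a b| *
      ∫ x in unitSq, evalP u (duffy a b x) * evalP v (duffy a b x) * duffyWeight x := by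
  rw [innerT, integral_tri h]
  congr 2
  ext x
  rw [duffy_eq a b, bubble_comb h, duffyWeight]
  ring

lemma innerT_self_nonneg {a b : ℝ × ℝ} (h : det2 a b ≠ 0) (u : MvPolynomial (Fin 2) ℝ) :
    0 ≤ innerT 0 a b u u := by
  rw [innerT_eq h]
  exact mul_nonneg (abs_nonneg _) (setIntegral_nonneg isCompact_unitSq.measurableSet
    fun x hx => mul_nonneg (mul_self_nonneg _) (duffyWeight_nonneg hx))

open MvPolynomial in
lemma exists_lowDegree {a b : ℝ × ℝ} (h : det2 a b ≠ 0) {n : ℕ} {j : ℕ × ℕ}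
    (hj : j ∈ lowExps n) (τ : ℝ) : ∃ w : MvPolynomial (Fin 2) ℝ, w.totalDegree ≤ n - 1 ∧
      ∀ x, evalP w (duffy a b x) = τ * (x.1 ^ (j.1 + j.2) * x.2 ^ j.1) := by
  let l₁ : MvPolynomial (Fin 2) ℝ := C (b.2 / det2 a b) * X 0 - C (b.1 / det2 a b) * X 1
  let l₂ : MvPolynomial (Fin 2) ℝ := C (a.1 / det2 a b) * X 1 - C (a.2 / det2 a b) * X 0
  have hlin (c : ℝ) (i : Fin 2) : (C c * X i : MvPolynomial (Fin 2) ℝ).totalDegree ≤ 1 :=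
    (totalDegree_mul _ _).trans (by simp)
  have h1 : l₁.totalDegree ≤ 1 :=
    (totalDegree_sub _ _).trans (max_le (hlin _ _) (hlin _ _))
  have h2 : l₂.totalDegree ≤ 1 :=
    (totalDegree_sub _ _).trans (max_le (hlin _ _) (hlin _ _))
  have h3 : (l₁ + l₂).totalDegree ≤ 1 := (totalDegree_add _ _).trans (max_le h1 h2)
  have e1 (x : ℝ × ℝ) : evalP l₁ (duffy a b x) = x.1 * x.2 := by
    simp only [evalP, l₁, map_sub, map_mul, eval_C, eval_X, duffy_eq]
    simp
    field_simp
    simp [det2]; ring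
  have e2 (x : ℝ × ℝ) : evalP l₂ (duffy a b x) = x.1 * (1 - x.2) := by
    simp only [evalP, l₂, map_sub, map_mul, eval_C, eval_X, duffy_eq]
    simp
    field_simp
    simp [det2]; ring
  refine ⟨C τ * (l₁ ^ j.1 * (l₁ + l₂) ^ j.2), ?_, fun x => ?_⟩
  · have := mem_lowExps.1 hj
    have h4 := totalDegree_mul (C τ) (l₁ ^ j.1 * (l₁ + l₂) ^ j.2)
    have h5 := totalDegree_mul (l₁ ^ j.1) ((l₁ + l₂) ^ j.2)
    have h6 := (totalDegree_pow l₁ j.1).trans (Nat.mul_le_mul_left _ h1)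
    have h7 := (totalDegree_pow (l₁ + l₂) j.2).trans (Nat.mul_le_mul_left _ h3)
    rw [totalDegree_C] at h4
    omega
  · have : evalP (C τ * (l₁ ^ j.1 * (l₁ + l₂) ^ j.2)) (duffy a b x) = τ *
        (evalP l₁ (duffy a b x) ^ j.1 *
          (evalP l₁ (duffy a b x) + evalP l₂ (duffy a b x)) ^ j.2) := by
      simp [evalP]
    rw [this, e1, e2, ← mul_add, add_sub_cancel, mul_one]
    ring

lemma exists_approx {a b : ℝ × ℝ} (h : det2 a b ≠ 0) {n : ℕ} {j : ℕ × ℕ} (hj : j ∈ lowExps n)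
    {v : MvPolynomial (Fin 2) ℝ} (hv : v.totalDegree ≤ n) :
    ∃ w : MvPolynomial (Fin 2) ℝ, w.totalDegree ≤ n - 1 ∧
      |det2 a b| * triMoment n (mvCoeff v) a b j ^ 2 ≤
        innerT 0 a b v v - innerT 0 a b (v - w) (v - w) := by
  set τ := triMoment n (mvCoeff v) a b j with hτ
  obtain ⟨w, hw, hev⟩ := exists_lowDegree h hj τ
  refine ⟨w, hw, ?_⟩
  rw [innerT_eq h, innerT_eq h, ← mul_sub]
  refine mul_le_mul_of_nonneg_left ?_ (abs_nonneg _)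
  have hcv := (continuous_evalP v).comp (continuous_duffy a b)
  have hcw : Continuous duffyWeight := by unfold duffyWeight; fun_prop
  have hint {f : ℝ × ℝ → ℝ} (hf : Continuous f) : IntegrableOn f unitSq :=
    hf.continuousOn.integrableOn_compact isCompact_unitSq
  let g : ℝ × ℝ → ℝ := fun x => x.1 ^ (j.1 + j.2) * x.2 ^ j.1
  have hg : Continuous g := by fun_prop
  have e1 : τ = ∫ x in unitSq, evalP v (duffy a b x) * g x * duffyWeight x := by
    rw [hτ, triMoment]
    simp only [evalP_eq_polyForm hv, g]
  have hle : ∫ x in unitSq, g x ^ 2 * duffyWeight x ≤ 1 := by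
    have hb : ∀ x ∈ unitSq, g x ^ 2 * duffyWeight x ≤ 1 := by
      rintro x ⟨⟨h1, h2⟩, h3, h4⟩
      have h5 : 0 ≤ 1 - x.1 := by linarith
      have h6 : 0 ≤ 1 - x.2 := by linarith
      have g0 : 0 ≤ g x := by positivity
      have g1 : g x ≤ 1 := mul_le_one₀ (pow_le_one₀ h1 h2) (by positivity) (pow_le_one₀ h3 h4)
      have d1 : duffyWeight x ≤ 1 := by
        unfold duffyWeight
        refine mul_le_one₀ (mul_le_one₀ (pow_le_one₀ h1 h2) h5 (by linarith)) (by positivity)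
          (mul_le_one₀ h4 h6 (by linarith))
      exact mul_le_one₀ (pow_le_one₀ g0 g1) (duffyWeight_nonneg ⟨⟨h1, h2⟩, h3, h4⟩) d1
    refine (setIntegral_mono_on (hint (by fun_prop)) (hint continuous_const)
      isCompact_unitSq.measurableSet hb).trans ?_
    rw [setIntegral_const, measureReal_def, unitSq, Measure.volume_eq_prod, Measure.prod_prod]
    simp
  have e2 : (∫ x in unitSq, evalP v (duffy a b x) * evalP v (duffy a b x) * duffyWeight x) -
      ∫ x in unitSq, evalP (v - w) (duffy a b x) * evalP (v - w) (duffy a b x) * duffyWeight x =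
      2 * τ * (∫ x in unitSq, evalP v (duffy a b x) * g x * duffyWeight x) -
        τ ^ 2 * ∫ x in unitSq, g x ^ 2 * duffyWeight x := by
    have hcvw := (continuous_evalP (v - w)).comp (continuous_duffy a b)
    simp only [Function.comp_def] at hcv hcvw
    rw [← integral_const_mul, ← integral_const_mul, ← integral_sub (hint (by fun_prop))
      (hint (by fun_prop)), ← integral_sub (hint (by fun_prop)) (hint (by fun_prop))]
    congr 1
    ext x
    have : evalP (v - w) (duffy a b x) = evalP v (duffy a b x) - τ * g x := by
      rw [← hev]; simp [evalP]
    rw [this]; ring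
  rw [e2, ← e1]
  nlinarith [mul_le_mul_of_nonneg_left hle (sq_nonneg τ)]

lemma integral_tri_sq {n : ℕ} {a b : ℝ × ℝ} (h : det2 a b ≠ 0) {v : MvPolynomial (Fin 2) ℝ}
    (hv : v.totalDegree ≤ n) :
    ∫ p in closure (tri 0 a b), evalP v p ^ 2 = |det2 a b| * triMass n (mvCoeff v) a b := by
  have hc : Convex ℝ (tri 0 a b) := (convex_convexHull ℝ _).interior
  rw [setIntegral_congr_set (closure_ae_eq_of_null_frontier (hc.addHaar_frontier volume)),
    integral_tri h]
  simp only [evalP_eq_polyForm hv, triMass]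

lemma isCompact_closure_tri (a b c : ℝ × ℝ) : IsCompact (closure (tri a b c)) := by
  have h : IsCompact (convexHull ℝ {a, b, c}) := (Set.toFinite _).isCompact_convexHull ℝ
  exact h.of_isClosed_subset isClosed_closure (closure_minimal interior_subset h.isClosed)

lemma tri_zero_nonempty {a b : ℝ × ℝ} (h : det2 a b ≠ 0) : (tri 0 a b).Nonempty :=
  ⟨_, (mem_tri_zero h _).2 ⟨1 / 3, 1 / 3, by norm_num, by norm_num, by norm_num, rfl⟩⟩

lemma eq_zero_of_evalP_eq_zero {v : MvPolynomial (Fin 2) ℝ} {U : Set (ℝ × ℝ)} (hU : IsOpen U)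
    (hne : U.Nonempty) (h : ∀ p ∈ U, evalP v p = 0) : v = 0 := by
  obtain ⟨p, hp⟩ := hne
  obtain ⟨ε, hε, hball⟩ := Metric.isOpen_iff.1 hU p hp
  refine MvPolynomial.funext_set (fun i => Metric.ball (![p.1, p.2] i) ε) (fun i => ?_)
    fun x hx => ?_
  · rw [Real.ball_eq_Ioo]
    exact Set.Ioo_infinite (by linarith)
  · have hx0 := hx 0 (Set.mem_univ _)
    have hx1 := hx 1 (Set.mem_univ _)
    have := h (x 0, x 1) (hball (by
      rw [← Prod.mk.eta (p := p), ← ball_prod_same]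
      exact ⟨hx0, hx1⟩))
    have hxe : ![x 0, x 1] = x := by ext i; fin_cases i <;> rfl
    rw [evalP, hxe] at this
    rw [this, map_zero]

namespace TrianglePatch

lemma neZero {q : ℕ} (T : TrianglePatch q) : NeZero q := ⟨by have := T.hq; omega⟩

variable {q : ℕ} (T : TrianglePatch q)

lemma det2_ne_zero (hz : T.z = 0) (i : ZMod q) : det2 (T.A (i - 1)) (T.A i) ≠ 0 :=
  det2_ne_zero_of_affineIndependent (hz ▸ T.indep i)

lemma patchInner_self_nonneg (hz : T.z = 0) (u : ZMod q → MvPolynomial (Fin 2) ℝ) :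
    0 ≤ patchInner T u u := by
  unfold patchInner
  rw [hz]
  exact Finset.sum_nonneg fun i _ => innerT_self_nonneg (T.det2_ne_zero hz i) _

lemma omega_subset : T.Omega ⊆ ⋃ i, closure (tri T.z (T.A (i - 1)) (T.A i)) := interior_subset

lemma tri_subset_omega (i : ZMod q) : tri T.z (T.A (i - 1)) (T.A i) ⊆ T.Omega :=
  interior_maximal (subset_closure.trans
    (Set.subset_iUnion (fun i => closure (tri T.z (T.A (i - 1)) (T.A i))) i)) isOpen_interior

lemma isCompact_iUnion_closure :
    IsCompact (⋃ i, closure (tri T.z (T.A (i - 1)) (T.A i))) :=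
  haveI := T.neZero
  isCompact_iUnion fun _ => isCompact_closure_tri _ _ _

lemma integrableOn_omega (v : MvPolynomial (Fin 2) ℝ) :
    IntegrableOn (fun p => evalP v p ^ 2) T.Omega :=
  (((continuous_evalP v).pow 2).continuousOn.integrableOn_compact
    T.isCompact_iUnion_closure).mono_set T.omega_subset

lemma integral_omega_le [NeZero q] (hz : T.z = 0) {n : ℕ} {v : MvPolynomial (Fin 2) ℝ}
    (hv : v.totalDegree ≤ n) :
    ∫ p in T.Omega, evalP v p ^ 2 ≤ patchMass n T.A (mvCoeff v) := by
  have hi (i : ZMod q) : IntegrableOn (fun p => evalP v p ^ 2)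
      (closure (tri T.z (T.A (i - 1)) (T.A i))) :=
    ((continuous_evalP v).pow 2).continuousOn.integrableOn_compact (isCompact_closure_tri _ _ _)
  have hle : volume.restrict T.Omega ≤
      ∑ i, volume.restrict (closure (tri T.z (T.A (i - 1)) (T.A i))) := by
    rw [← Measure.sum_fintype]
    exact (Measure.restrict_mono T.omega_subset le_rfl).trans Measure.restrict_iUnion_le
  refine (integral_mono_measure hle (Filter.Eventually.of_forall fun p => sq_nonneg _)
    (integrable_finsetSum_measure.2 fun i _ => hi i)).trans ?_
  rw [integral_finsetSum_measure fun i _ => hi i, patchMass, hz]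
  exact (Finset.sum_congr rfl fun i _ => integral_tri_sq (T.det2_ne_zero hz i) hv).le

lemma integral_omega_pos (hz : T.z = 0) {v : MvPolynomial (Fin 2) ℝ} (hv : v ≠ 0) :
    0 < ∫ p in T.Omega, evalP v p ^ 2 := by
  have ho : IsOpen T.Omega := isOpen_interior
  refine (setIntegral_nonneg ho.measurableSet fun p _ => sq_nonneg _).lt_of_ne' fun h => hv ?_
  rw [setIntegral_eq_zero_iff_of_nonneg_ae (Filter.Eventually.of_forall fun p => sq_nonneg _)
    (T.integrableOn_omega v)] at h
  have hne : T.Omega.Nonempty := by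
    refine (tri_zero_nonempty (T.det2_ne_zero hz 0)).mono ?_
    rw [← hz]
    exact T.tri_subset_omega 0
  refine eq_zero_of_evalP_eq_zero ho hne fun p hp => ?_
  have := Measure.eqOn_open_of_ae_eq h ho ((continuous_evalP v).pow 2).continuousOn
    continuousOn_const hp
  simpa using this

/-- The numerator in the definition of `chat`. -/
def projEnergy (n : ℕ) (v : MvPolynomial (Fin 2) ℝ) : ℝ :=
  patchInner T (fun _ => v) (fun _ => v) -
    sInf {s : ℝ | ∃ w : ZMod q → MvPolynomial (Fin 2) ℝ,
      (∀ i, (w i).totalDegree ≤ n - 1) ∧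
      s = patchInner T (fun i => v - w i) (fun i => v - w i)}

lemma sum_triMoment_sq_le [NeZero q] (hz : T.z = 0) {n : ℕ} {j : ℕ × ℕ} (hj : j ∈ lowExps n)
    {v : MvPolynomial (Fin 2) ℝ} (hv : v.totalDegree ≤ n) :
    ∑ i, |det2 (T.A (i - 1)) (T.A i)| * triMoment n (mvCoeff v) (T.A (i - 1)) (T.A i) j ^ 2 ≤
      T.projEnergy n v := by
  choose w hw hle using fun i => exists_approx (T.det2_ne_zero hz i) hj hv
  have h1 : sInf {s : ℝ | ∃ w : ZMod q → MvPolynomial (Fin 2) ℝ,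
      (∀ i, (w i).totalDegree ≤ n - 1) ∧
      s = patchInner T (fun i => v - w i) (fun i => v - w i)} ≤
        patchInner T (fun i => v - w i) (fun i => v - w i) := by
    refine csInf_le ⟨0, ?_⟩ ⟨w, hw, rfl⟩
    rintro _ ⟨w', -, rfl⟩
    exact T.patchInner_self_nonneg hz _
  refine le_trans ?_ (sub_le_sub_left h1 _)
  unfold patchInner
  rw [← Finset.sum_sub_distrib, hz]
  exact Finset.sum_le_sum fun i _ => hle i

end TrianglePatch

lemma polyForm_smul_point (n : ℕ) (c : ℕ × ℕ → ℝ) (r : ℝ) (p : ℝ × ℝ) :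
    polyForm n c (r • p) = polyForm n (fun m => r ^ (m.1 + m.2) * c m) p := by
  refine Finset.sum_congr rfl fun k _ => Finset.sum_congr rfl fun m _ => ?_
  simp only [Prod.smul_fst, Prod.smul_snd, smul_eq_mul, mul_pow, pow_add]
  ring

lemma duffy_smul (r : ℝ) (a b x : ℝ × ℝ) : duffy (r • a) (r • b) x = r • duffy a b x := by
  unfold duffy; module

lemma triMoment_smul (n : ℕ) (c : ℕ × ℕ → ℝ) (r : ℝ) (a b : ℝ × ℝ) (j : ℕ × ℕ) :
    triMoment n c (r • a) (r • b) j =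
      triMoment n (fun m => r ^ (m.1 + m.2) * c m) a b j := by
  simp only [triMoment, duffy_smul, polyForm_smul_point]

lemma triMass_smul (n : ℕ) (c : ℕ × ℕ → ℝ) (r : ℝ) (a b : ℝ × ℝ) :
    triMass n c (r • a) (r • b) = triMass n (fun m => r ^ (m.1 + m.2) * c m) a b := by
  simp only [triMass, duffy_smul, polyForm_smul_point]

lemma det2_smul_smul (r : ℝ) (a b : ℝ × ℝ) : det2 (r • a) (r • b) = r ^ 2 * det2 a b := by
  simp [det2]; ring

/-- On patches whose rescaled vertices range over a compact family, the projection energy controls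
the `L²` norm uniformly. -/
lemma exists_le_chat {q : ℕ} (hq : 3 ≤ q) (n : ℕ) (hn : 1 ≤ n) (R : ℝ) {d : ℝ} (hd : 0 < d) :
    ∃ ε > 0, ∀ T : TrianglePatch q, T.z = 0 →
      (∃ r > (0 : ℝ), (fun i => r⁻¹ • T.A i) ∈ fanSet q R d) → ε ≤ chat n T := by
  have : NeZero q := ⟨by omega⟩
  obtain ⟨C, hC, hle⟩ := exists_patchMass_le hq n hn R hd
  have hN : 0 < ((lowExps n).card : ℝ) := by
    exact_mod_cast Finset.card_pos.2 ⟨(0, 0), mem_lowExps.2 hn⟩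
  refine ⟨d / (C * (lowExps n).card), by positivity, ?_⟩
  rintro T hz ⟨r, hr, hB⟩
  refine le_csInf ⟨_, 1, one_ne_zero, by simp, rfl⟩ ?_
  rintro _ ⟨v, hv0, hv, rfl⟩
  rw [le_div_iff₀ (T.integral_omega_pos hz hv0)]
  change _ ≤ T.projEnergy n v
  obtain ⟨B, hBdef⟩ : ∃ B : ZMod q → ℝ × ℝ, B = fun i => r⁻¹ • T.A i := ⟨_, rfl⟩
  rw [← hBdef] at hB
  have hA (i : ZMod q) : T.A i = r • B i := by simp [hBdef, smul_smul, hr.ne']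
  obtain ⟨c, hc⟩ : ∃ c : ℕ × ℕ → ℝ, c = fun m => r ^ (m.1 + m.2) * mvCoeff v m := ⟨_, rfl⟩
  have h1 : r ^ 2 * d * patchMoments n B c ≤ (lowExps n).card * T.projEnergy n v := by
    rw [← nsmul_eq_mul, ← Finset.sum_const]
    refine le_trans ?_ (Finset.sum_le_sum fun j hj => T.sum_triMoment_sq_le hz hj hv)
    rw [Finset.sum_comm, patchMoments, Finset.mul_sum]
    refine Finset.sum_le_sum fun i _ => ?_
    rw [Finset.mul_sum]
    refine Finset.sum_le_sum fun j _ => ?_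
    rw [hA, hA, det2_smul_smul, triMoment_smul, ← hc, abs_mul, abs_of_nonneg (sq_nonneg r)]
    gcongr
    exact hB.2.1 i
  have h2 : patchMass n T.A (mvCoeff v) = r ^ 2 * patchMass n B c := by
    rw [patchMass, patchMass, Finset.mul_sum]
    refine Finset.sum_congr rfl fun i _ => ?_
    rw [hA, hA, det2_smul_smul, triMass_smul, ← hc, abs_mul, abs_of_nonneg (sq_nonneg r)]
    ring
  have h3 := T.integral_omega_le hz hv
  rw [h2] at h3
  have h4 := mul_le_mul_of_nonneg_left (hle B hB c) (sq_nonneg r)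
  rw [div_mul_eq_mul_div, div_le_iff₀ (mul_pos hC hN)]
  calc d * ∫ p in T.Omega, evalP v p ^ 2 ≤ d * (r ^ 2 * (C * patchMoments n B c)) := by
        gcongr
        exact h3.trans h4
    _ = C * (r ^ 2 * d * patchMoments n B c) := by ring
    _ ≤ C * ((lowExps n).card * T.projEnergy n v) := by gcongr
    _ = T.projEnergy n v * (C * (lowExps n).card) := by ring

/-- A point of `ℝ × ℝ` as a vector of the Euclidean plane. -/
def toPlane (p : ℝ × ℝ) : EuclideanSpace ℝ (Fin 2) := !₂[p.1, p.2]

lemma inner_toPlane (p p' : ℝ × ℝ) : inner ℝ (toPlane p) (toPlane p') = dot2 p p' := by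
  simp [toPlane, dot2, PiLp.inner_apply, Fin.sum_univ_two, mul_comm]

lemma norm_toPlane (p : ℝ × ℝ) : ‖toPlane p‖ = nrm2 p := by
  rw [nrm2, ← inner_toPlane, real_inner_self_eq_norm_sq, Real.sqrt_sq (norm_nonneg _)]

lemma ang_eq_angle (p p' : ℝ × ℝ) :
    ang p p' = InnerProductGeometry.angle (toPlane p) (toPlane p') := by
  rw [ang, InnerProductGeometry.angle, inner_toPlane, norm_toPlane, norm_toPlane]

lemma toPlane_sub (p p' : ℝ × ℝ) : toPlane (p - p') = toPlane p - toPlane p' := by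
  ext i; fin_cases i <;> simp [toPlane]

lemma toPlane_ne_zero {p : ℝ × ℝ} (hp : p ≠ 0) : toPlane p ≠ 0 := by
  refine fun h => hp (Prod.ext ?_ ?_)
  · simpa [toPlane] using congrArg (fun v : EuclideanSpace ℝ (Fin 2) => v 0) h
  · simpa [toPlane] using congrArg (fun v : EuclideanSpace ℝ (Fin 2) => v 1) h

lemma nrm2_pos {p : ℝ × ℝ} (hp : p ≠ 0) : 0 < nrm2 p := by
  rw [← norm_toPlane]; exact norm_pos_iff.2 (toPlane_ne_zero hp)

lemma nrm2_nonneg (p : ℝ × ℝ) : 0 ≤ nrm2 p := Real.sqrt_nonneg _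

lemma nrm2_sub_comm (p p' : ℝ × ℝ) : nrm2 (p - p') = nrm2 (p' - p) := by
  rw [← norm_toPlane, ← norm_toPlane, toPlane_sub, toPlane_sub, norm_sub_rev]

lemma norm_le_nrm2 (p : ℝ × ℝ) : ‖p‖ ≤ nrm2 p := by
  rw [Prod.norm_def, nrm2, dot2]
  refine max_le (Real.le_sqrt_of_sq_le ?_) (Real.le_sqrt_of_sq_le ?_) <;>
    rw [Real.norm_eq_abs, sq_abs] <;> nlinarith [sq_nonneg p.1, sq_nonneg p.2]

lemma abs_det2_eq (a b : ℝ × ℝ) : |det2 a b| = Real.sin (ang a b) * (nrm2 a * nrm2 b) := by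
  rw [ang_eq_angle, ← norm_toPlane, ← norm_toPlane,
    InnerProductGeometry.sin_angle_mul_norm_mul_norm, inner_toPlane, inner_toPlane, inner_toPlane,
    ← Real.sqrt_sq_eq_abs]
  congr 1
  simp only [det2, dot2]
  ring

lemma abs_det2_le (a b : ℝ × ℝ) : |det2 a b| ≤ nrm2 a * nrm2 b := by
  rw [abs_det2_eq]
  exact mul_le_of_le_one_left (mul_nonneg (nrm2_nonneg _) (nrm2_nonneg _)) (Real.sin_le_one _)

lemma ne_zero_of_det2_ne_zero {a b : ℝ × ℝ} (h : det2 a b ≠ 0) : a ≠ 0 ∧ b ≠ 0 ∧ a - b ≠ 0 := by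
  refine ⟨?_, ?_, fun hab => ?_⟩
  · rintro rfl; simp [det2] at h
  · rintro rfl; simp [det2] at h
  · rw [sub_eq_zero.1 hab] at h
    exact h (by simp [det2]; ring)

lemma angle_sum {a b : ℝ × ℝ} (h : det2 a b ≠ 0) :
    ang a b + ang (0 - a) (b - a) + ang (0 - b) (a - b) = Real.pi := by
  obtain ⟨ha, -, -⟩ := ne_zero_of_det2_ne_zero h
  rw [← InnerProductGeometry.angle_add_angle_sub_add_angle_sub_eq_pi (toPlane b)
    (toPlane_ne_zero ha), ang_eq_angle, ang_eq_angle, ang_eq_angle,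
    ← InnerProductGeometry.angle_neg_neg (toPlane (0 - a)),
    ← InnerProductGeometry.angle_neg_neg (toPlane (0 - b)),
    ← toPlane_sub, ← toPlane_sub]
  have hn (p : ℝ × ℝ) : -toPlane p = toPlane (-p) := by
    ext i; fin_cases i <;> simp [toPlane]
  simp only [hn, neg_sub, sub_zero]
  rw [InnerProductGeometry.angle_comm (toPlane b) (toPlane a)]
  ring

/-- In a triangle with angles at least `δ`, the determinant controls products of side lengths and
adjacent sides are comparable. -/
lemma shape_bounds {a b : ℝ × ℝ} (h : det2 a b ≠ 0) {δ : ℝ} (hδ : 0 < δ)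
    (h1 : δ ≤ ang a b) (h2 : δ ≤ ang (0 - a) (b - a)) (h3 : δ ≤ ang (0 - b) (a - b)) :
    Real.sin δ * (nrm2 a * nrm2 b) ≤ |det2 a b| ∧ Real.sin δ * nrm2 a ≤ nrm2 b ∧
      Real.sin δ * nrm2 b ≤ nrm2 a := by
  obtain ⟨ha, hb, hab⟩ := ne_zero_of_det2_ne_zero h
  have hsum := angle_sum h
  have hsin {x : ℝ} (hx : δ ≤ x) (hx' : x ≤ Real.pi - δ) : Real.sin δ ≤ Real.sin x := by
    rcases le_total x (Real.pi / 2) with hle | hle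
    · exact Real.sin_le_sin_of_le_of_le_pi_div_two (by linarith) hle hx
    · rw [← Real.sin_pi_sub x]
      exact Real.sin_le_sin_of_le_of_le_pi_div_two (by linarith) (by linarith) (by linarith)
  have hn (p : ℝ × ℝ) : nrm2 (0 - p) = nrm2 p := by rw [nrm2_sub_comm, sub_zero]
  have e1 := abs_det2_eq a b
  have e2 := abs_det2_eq (0 - a) (b - a)
  have e3 := abs_det2_eq (0 - b) (a - b)
  have d2 : |det2 (0 - a) (b - a)| = |det2 a b| := by
    rw [← abs_neg]; congr 1; simp [det2]; ring
  have d3 : |det2 (0 - b) (a - b)| = |det2 a b| := by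
    congr 1; simp [det2]; ring
  rw [d2, hn, nrm2_sub_comm b a] at e2
  rw [d3, hn] at e3
  have l2 := abs_det2_le (0 - a) (b - a)
  have l3 := abs_det2_le (0 - b) (a - b)
  rw [d2, hn, nrm2_sub_comm b a] at l2
  rw [d3, hn] at l3
  have pab := nrm2_pos hab
  refine ⟨?_, le_of_mul_le_mul_right ?_ pab, le_of_mul_le_mul_right ?_ pab⟩
  · rw [e1]
    exact mul_le_mul_of_nonneg_right (hsin h1 (by linarith))
      (mul_nonneg (nrm2_nonneg _) (nrm2_nonneg _))
  · refine le_trans ?_ l3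
    rw [e2, mul_assoc]
    exact mul_le_mul_of_nonneg_right (hsin h2 (by linarith))
      (mul_nonneg (nrm2_nonneg _) (nrm2_nonneg _))
  · refine le_trans ?_ l2
    rw [e3, mul_assoc]
    exact mul_le_mul_of_nonneg_right (hsin h3 (by linarith))
      (mul_nonneg (nrm2_nonneg _) (nrm2_nonneg _))

lemma InCone.smul_mem_tri {a b p : ℝ × ℝ} (h : det2 a b ≠ 0) (hp : InCone a b p) :
    ∀ᶠ ε : ℝ in nhdsWithin 0 (Set.Ioi 0), ε • p ∈ tri 0 a b := by
  have hs : 0 < det2 p b / det2 a b := by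
    rw [← mul_div_mul_right _ _ h]; exact div_pos hp.1 (mul_self_pos.2 h)
  have ht : 0 < det2 a p / det2 a b := by
    rw [← mul_div_mul_right _ _ h]; exact div_pos hp.2 (mul_self_pos.2 h)
  have hlim : ∀ᶠ ε : ℝ in nhdsWithin 0 (Set.Ioi 0),
      ε * (det2 p b / det2 a b + det2 a p / det2 a b) < 1 := by
    have hc : Continuous fun ε : ℝ => ε * (det2 p b / det2 a b + det2 a p / det2 a b) := by
      fun_prop
    refine nhdsWithin_le_nhds ((hc.tendsto 0).eventually (gt_mem_nhds ?_))
    simp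
  filter_upwards [hlim, self_mem_nhdsWithin] with ε h1 h2
  refine (mem_tri_zero h _).2 ⟨ε * (det2 p b / det2 a b), ε * (det2 a p / det2 a b),
    mul_pos h2 hs, mul_pos h2 ht, by rwa [← mul_add], ?_⟩
  conv_lhs => rw [eq_comb h p]
  module

lemma inCone_smul_smul {a b p : ℝ × ℝ} {s t : ℝ} (hs : 0 < s) (ht : 0 < t) :
    InCone (s • a) (t • b) p ↔ InCone a b p := by
  have h1 : det2 p (t • b) * det2 (s • a) (t • b) = (s * t ^ 2) * (det2 p b * det2 a b) := by
    simp [det2]; ring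
  have h2 : det2 (s • a) p * det2 (s • a) (t • b) = (s ^ 2 * t) * (det2 a p * det2 a b) := by
    simp [det2]; ring
  have h3 : 0 < s * t ^ 2 := by positivity
  have h4 : 0 < s ^ 2 * t := by positivity
  rw [InCone, InCone, h1, h2, mul_pos_iff_of_pos_left h3, mul_pos_iff_of_pos_left h4]

namespace TrianglePatch

variable {q : ℕ} (T : TrianglePatch q)

lemma not_inCone_of_ne (hz : T.z = 0) (i j : ZMod q) (p : ℝ × ℝ) (hij : i ≠ j)
    (hi : InCone (T.A (i - 1)) (T.A i) p) : ¬ InCone (T.A (j - 1)) (T.A j) p := by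
  intro hj
  obtain ⟨ε, h1, h2⟩ := ((hi.smul_mem_tri (T.det2_ne_zero hz i)).and
    (hj.smul_mem_tri (T.det2_ne_zero hz j))).exists
  rw [← hz] at h1 h2
  exact Set.disjoint_left.1 (T.disj hij) h1 h2

lemma exists_closed_cone (hz : T.z = 0) (p : ℝ × ℝ) :
    ∃ i, 0 ≤ det2 p (T.A i) * det2 (T.A (i - 1)) (T.A i) ∧
      0 ≤ det2 (T.A (i - 1)) p * det2 (T.A (i - 1)) (T.A i) := by
  obtain ⟨ρ, hρ, hball⟩ := T.covers
  rw [hz] at hball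
  have hc : Continuous fun ε : ℝ => ε • p := by fun_prop
  have hev : ∀ᶠ ε : ℝ in nhdsWithin 0 (Set.Ioi 0), ε • p ∈ Metric.ball (0 : ℝ × ℝ) ρ :=
    nhdsWithin_le_nhds ((hc.tendsto 0).eventually
      (by rw [zero_smul]; exact Metric.ball_mem_nhds (0 : ℝ × ℝ) hρ))
  obtain ⟨ε, h1, hε⟩ := (hev.and self_mem_nhdsWithin).exists
  obtain ⟨i, hi⟩ := Set.mem_iUnion.1 (hball h1)
  have hcl : closure (tri 0 (T.A (i - 1)) (T.A i)) ⊆ convexHull ℝ {0, T.A (i - 1), T.A i} :=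
    closure_minimal interior_subset ((Set.toFinite _).isClosed_convexHull ℝ)
  obtain ⟨s, t, hs, ht, -, he⟩ := (mem_convexHull_zero _).1 (hcl hi)
  have hp : p = (ε⁻¹ * s) • T.A (i - 1) + (ε⁻¹ * t) • T.A i := by
    rw [mul_smul, mul_smul, ← smul_add, ← he, smul_smul, inv_mul_cancel₀ (ne_of_gt hε), one_smul]
  have hε' : 0 ≤ ε⁻¹ := inv_nonneg.2 (le_of_lt hε)
  refine ⟨i, ?_, ?_⟩
  · rw [hp, det2_comb_left, mul_assoc]
    exact mul_nonneg (mul_nonneg hε' hs) (mul_self_nonneg _)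
  · rw [hp, det2_comb_right, mul_assoc]
    exact mul_nonneg (mul_nonneg hε' ht) (mul_self_nonneg _)

end TrianglePatch

lemma abs_det2_le_norm (p : ℝ × ℝ) {b : ℝ × ℝ} (h : ‖b‖ ≤ 1) : |det2 p b| ≤ 2 * ‖p‖ := by
  have h1 : |p.1 * b.2| ≤ ‖p‖ := by
    rw [abs_mul]
    exact (mul_le_mul (norm_fst_le p) ((norm_snd_le b).trans h) (abs_nonneg _)
      (norm_nonneg _)).trans_eq (mul_one _)
  have h2 : |p.2 * b.1| ≤ ‖p‖ := by
    rw [abs_mul]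
    exact (mul_le_mul (norm_snd_le p) ((norm_fst_le b).trans h) (abs_nonneg _)
      (norm_nonneg _)).trans_eq (mul_one _)
  unfold det2
  linarith [abs_sub (p.1 * b.2) (p.2 * b.1)]

namespace TrianglePatch

variable {q : ℕ} {T : TrianglePatch q} {δ ρ : ℝ}

lemma shape_bounds (hδ : 0 < δ) (hT : goodPatch q δ ρ T) (i : ZMod q) :
    Real.sin δ * (nrm2 (T.A (i - 1)) * nrm2 (T.A i)) ≤ |det2 (T.A (i - 1)) (T.A i)| ∧
      Real.sin δ * nrm2 (T.A (i - 1)) ≤ nrm2 (T.A i) ∧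
      Real.sin δ * nrm2 (T.A i) ≤ nrm2 (T.A (i - 1)) := by
  obtain ⟨hz, -, -, h⟩ := hT
  obtain ⟨h1, h2, h3, -⟩ := h i
  rw [hz, ← Prod.zero_eq_mk] at h1 h2 h3
  rw [sub_zero, sub_zero] at h1
  exact _root_.shape_bounds (T.det2_ne_zero hz i) hδ h1 h2 h3

lemma nrm2_vertex_pos (hz : T.z = 0) (i : ZMod q) : 0 < nrm2 (T.A i) :=
  nrm2_pos (ne_zero_of_det2_ne_zero (T.det2_ne_zero hz i)).2.1

lemma nrm2_bounds (hδ : 0 < δ) (hδ' : δ < Real.pi) (hT : goodPatch q δ ρ T) (i : ZMod q) :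
    Real.sin δ ^ q * nrm2 (T.A 0) ≤ nrm2 (T.A i) ∧
      Real.sin δ ^ q * nrm2 (T.A i) ≤ nrm2 (T.A 0) := by
  have := T.neZero
  have hs := Real.sin_pos_of_pos_of_lt_pi hδ hδ'
  have key (k : ℕ) : Real.sin δ ^ k * nrm2 (T.A 0) ≤ nrm2 (T.A k) ∧
      Real.sin δ ^ k * nrm2 (T.A k) ≤ nrm2 (T.A 0) := by
    induction k with
    | zero => simp
    | succ k ih =>
      obtain ⟨-, h1, h2⟩ := shape_bounds hδ hT ((k + 1 : ℕ) : ZMod q)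
      rw [Nat.cast_succ, add_sub_cancel_right] at h1 h2
      rw [Nat.cast_succ]
      constructor
      · rw [pow_succ', mul_assoc]
        exact (mul_le_mul_of_nonneg_left ih.1 hs.le).trans h1
      · rw [pow_succ, mul_assoc]
        exact (mul_le_mul_of_nonneg_left h2 (pow_pos hs k).le).trans ih.2
  have hpow : Real.sin δ ^ q ≤ Real.sin δ ^ i.val :=
    pow_le_pow_of_le_one hs.le (Real.sin_le_one δ) (ZMod.val_lt i).le
  have hk := key i.val
  rw [ZMod.natCast_zmod_val] at hk
  exact ⟨(mul_le_mul_of_nonneg_right hpow (nrm2_nonneg _)).trans hk.1,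
    (mul_le_mul_of_nonneg_right hpow (nrm2_nonneg _)).trans hk.2⟩

lemma smul_mem_fanSet (hδ : 0 < δ) (hδ' : δ < Real.pi) (hT : goodPatch q δ ρ T) :
    (fun i => (nrm2 (T.A 0))⁻¹ • T.A i) ∈
      fanSet q (Real.sin δ ^ q)⁻¹ (Real.sin δ * (Real.sin δ ^ q * Real.sin δ ^ q)) := by
  have hz : T.z = 0 := hT.1
  have hs := Real.sin_pos_of_pos_of_lt_pi hδ hδ'
  have hr := nrm2_vertex_pos hz 0
  have hr' := inv_pos.2 hr
  have hp := pow_pos hs q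
  refine ⟨fun i => ?_, fun i => ?_, fun i j p hij hi => ?_, fun p => ?_⟩
  · rw [norm_smul, Real.norm_of_nonneg hr'.le, inv_mul_le_iff₀ hr, ← div_eq_mul_inv,
      le_div_iff₀ hp, mul_comm]
    exact (mul_le_mul_of_nonneg_left (norm_le_nrm2 _) hp.le).trans (nrm2_bounds hδ hδ' hT i).2
  · have h1 := (nrm2_bounds hδ hδ' hT i).1
    have h2 := (nrm2_bounds hδ hδ' hT (i - 1)).1
    rw [det2_smul_smul, abs_mul, abs_of_nonneg (sq_nonneg _), inv_pow, ← div_eq_inv_mul,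
      le_div_iff₀ (by positivity)]
    refine le_trans ?_ (shape_bounds hδ hT i).1
    rw [mul_assoc]
    refine mul_le_mul_of_nonneg_left ?_ hs.le
    calc _ = (Real.sin δ ^ q * nrm2 (T.A 0)) * (Real.sin δ ^ q * nrm2 (T.A 0)) := by ring
      _ ≤ _ := mul_le_mul h2 h1 (by positivity) (nrm2_nonneg _)
  · rw [inCone_smul_smul hr' hr'] at hi ⊢
    exact T.not_inCone_of_ne hz i j p hij hi
  · obtain ⟨i, h1, h2⟩ := T.exists_closed_cone hz p
    refine ⟨i, ?_, ?_⟩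
    · refine (mul_nonneg (pow_nonneg hr'.le 3) h1).trans_eq ?_
      simp [det2]; ring
    · refine (mul_nonneg (pow_nonneg hr'.le 3) h2).trans_eq ?_
      simp [det2]; ring

lemma inCone_of_norm_lt {a b x : ℝ × ℝ} {s : ℝ} (ha : ‖a‖ ≤ 1) (hb : ‖b‖ ≤ 1)
    (hs : s ≤ |det2 a b|) (hx : ‖x - (a + b)‖ < s / 2) : InCone a b x := by
  obtain ⟨y, rfl⟩ : ∃ y, x = a + b + y := ⟨x - (a + b), by abel⟩
  rw [add_sub_cancel_left] at hx
  have hpos (D t : ℝ) (h : |t| < |D|) : 0 < (D + t) * D := by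
    rcases abs_cases D with ⟨h1, h2⟩ | ⟨h1, h2⟩ <;> rw [h1] at h
    · have := abs_lt.1 h
      exact mul_pos (by linarith) (by linarith)
    · have := abs_lt.1 h
      exact mul_pos_of_neg_of_neg (by linarith) (by linarith)
  constructor
  · convert hpos (det2 a b) (det2 y b) (by linarith [abs_det2_le_norm y hb]) using 2
    simp [det2]; ring
  · convert hpos (det2 a b) (-det2 y a) (by rw [abs_neg]; linarith [abs_det2_le_norm y ha]) using 2
    simp [det2]; ring

lemma exists_card_bound (hδ : 0 < δ) (hδ' : δ < Real.pi) : ∃ Q : ℕ, ∀ (q : ℕ) (ρ : ℝ)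
    (T : TrianglePatch q), goodPatch q δ ρ T → q ≤ Q := by
  have hs := Real.sin_pos_of_pos_of_lt_pi hδ hδ'
  obtain ⟨t, -, ht, hcov⟩ := Metric.finite_approx_of_totallyBounded
    (isCompact_closedBall (0 : ℝ × ℝ) 2).totallyBounded (Real.sin δ / 4) (by positivity)
  refine ⟨ht.toFinset.card, fun q ρ T hT => ?_⟩
  have := T.neZero
  have hz : T.z = 0 := hT.1
  let e : ZMod q → ℝ × ℝ := fun i => (nrm2 (T.A i))⁻¹ • T.A i
  have he (i : ZMod q) : ‖e i‖ ≤ 1 := by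
    rw [norm_smul, norm_inv, Real.norm_of_nonneg (nrm2_nonneg _),
      inv_mul_le_iff₀ (nrm2_vertex_pos hz i), mul_one]
    exact norm_le_nrm2 _
  have hdet (i : ZMod q) : Real.sin δ ≤ |det2 (e (i - 1)) (e i)| := by
    have h1 := nrm2_vertex_pos hz i
    have h2 := nrm2_vertex_pos hz (i - 1)
    have h3 : det2 (e (i - 1)) (e i) = det2 (T.A (i - 1)) (T.A i) /
        (nrm2 (T.A (i - 1)) * nrm2 (T.A i)) := by
      simp only [e, det2, Prod.smul_fst, Prod.smul_snd, smul_eq_mul]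
      field_simp
    rw [h3, abs_div, abs_of_pos (mul_pos h2 h1), le_div_iff₀ (mul_pos h2 h1)]
    exact (shape_bounds hδ hT i).1
  have hmid (i : ZMod q) : ∃ y ∈ t, dist (e (i - 1) + e i) y < Real.sin δ / 4 := by
    have hm : e (i - 1) + e i ∈ Metric.closedBall (0 : ℝ × ℝ) 2 := by
      rw [mem_closedBall_zero_iff]
      linarith [norm_add_le (e (i - 1)) (e i), he i, he (i - 1)]
    simpa only [Set.mem_iUnion, Metric.mem_ball, exists_prop] using hcov hm
  choose f hft hfd using hmid
  have hcone (i : ZMod q) (x : ℝ × ℝ) (hx : ‖x - (e (i - 1) + e i)‖ < Real.sin δ / 2) :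
      InCone (T.A (i - 1)) (T.A i) x :=
    (inCone_smul_smul (inv_pos.2 (nrm2_vertex_pos hz _)) (inv_pos.2 (nrm2_vertex_pos hz _))).1
      (inCone_of_norm_lt (he _) (he _) (hdet i) hx)
  have hinj : Function.Injective f := by
    intro i j hij
    by_contra hne
    refine T.not_inCone_of_ne hz i j (f i) hne (hcone i _ ?_) (hcone j _ ?_)
    · rw [← dist_eq_norm, dist_comm]; linarith [hfd i]
    · rw [hij, ← dist_eq_norm, dist_comm]; linarith [hfd j]
  calc q = Fintype.card (ZMod q) := (ZMod.card q).symm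
    _ ≤ _ := Finset.card_le_card_of_injOn f (by simpa using hft) hinj.injOn

end TrianglePatch

/-- Patches with angles at least `δ` have uniformly bounded `chat` from below. -/
lemma exists_le_chat_of_goodPatch (n : ℕ) (hn : 1 ≤ n) {δ : ℝ} (hδ : 0 < δ)
    (hδ' : δ < Real.pi) : ∃ ε > 0, ∀ (q : ℕ) (ρ : ℝ) (T : TrianglePatch q),
      goodPatch q δ ρ T → ε ≤ chat n T := by
  have hs := Real.sin_pos_of_pos_of_lt_pi hδ hδ'
  have hq (q : ℕ) : ∃ ε > 0, ∀ (ρ : ℝ) (T : TrianglePatch q),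
      goodPatch q δ ρ T → ε ≤ chat n T := by
    by_cases h3 : 3 ≤ q
    · obtain ⟨ε, hε, h⟩ := exists_le_chat h3 n hn (Real.sin δ ^ q)⁻¹
        (d := Real.sin δ * (Real.sin δ ^ q * Real.sin δ ^ q)) (by positivity)
      exact ⟨ε, hε, fun ρ T hT => h T hT.1 ⟨_, TrianglePatch.nrm2_vertex_pos hT.1 0,
        TrianglePatch.smul_mem_fanSet hδ hδ' hT⟩⟩
    · exact ⟨1, one_pos, fun ρ T => absurd T.hq h3⟩
  choose ε hε hle using hq
  obtain ⟨Q, hQ⟩ := TrianglePatch.exists_card_bound hδ hδ'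
  have hne : (range (Q + 1)).Nonempty := ⟨0, by simp⟩
  refine ⟨(range (Q + 1)).inf' hne ε, (Finset.lt_inf'_iff hne).2 fun q _ => hε q,
    fun q ρ T hT => (Finset.inf'_le ε ?_).trans (hle q ρ T hT)⟩
  exact Finset.mem_range.2 (Nat.lt_succ_of_le (hQ q ρ T hT))

/-- The vertices of the regular hexagon. -/
def hexVertex (i : ZMod 6) : ℝ × ℝ :=
  (![(1, 0), (1 / 2, √3 / 2), (-1 / 2, √3 / 2), (-1, 0), (-1 / 2, -√3 / 2), (1 / 2, -√3 / 2)] :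
    Fin 6 → ℝ × ℝ) i

lemma hexVertex_rel (p : ℝ × ℝ) :
    det2 (hexVertex 2) p = det2 (hexVertex 1) p - det2 (hexVertex 0) p ∧
      det2 (hexVertex 3) p = -det2 (hexVertex 0) p ∧
      det2 (hexVertex 4) p = -det2 (hexVertex 1) p ∧
      det2 (hexVertex 5) p = -det2 (hexVertex 2) p := by
  refine ⟨?_, ?_, ?_, ?_⟩ <;> simp [hexVertex, det2] <;> ring

lemma hexVertex_dot (i : ZMod 6) : dot2 (hexVertex i) (hexVertex i) = 1 ∧
    dot2 (hexVertex (i - 1)) (hexVertex i) = 1 / 2 ∧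
    det2 (hexVertex (i - 1)) (hexVertex i) = √3 / 2 := by
  have h3 : √3 * √3 = 3 := Real.mul_self_sqrt (by norm_num)
  have key (j k : ZMod 6) (hjk : j - 1 = k) (hk : dot2 (hexVertex j) (hexVertex j) = 1 ∧
      dot2 (hexVertex k) (hexVertex j) = 1 / 2 ∧ det2 (hexVertex k) (hexVertex j) = √3 / 2) :
      dot2 (hexVertex j) (hexVertex j) = 1 ∧
      dot2 (hexVertex (j - 1)) (hexVertex j) = 1 / 2 ∧
      det2 (hexVertex (j - 1)) (hexVertex j) = √3 / 2 := hjk ▸ hk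
  fin_cases i
  · refine key 0 5 rfl ?_
    simp [hexVertex, dot2, det2]; ring_nf
  · refine key 1 0 rfl ?_
    simp [hexVertex, dot2, det2]; linarith
  · refine key 2 1 rfl ?_
    simp [hexVertex, dot2, det2]; constructor <;> [skip; constructor] <;> linarith
  · refine key 3 2 rfl ?_
    simp [hexVertex, dot2, det2]; norm_num
  · refine key 4 3 rfl ?_
    simp [hexVertex, dot2, det2]; refine ⟨?_, ?_, ?_⟩ <;> linarith
  · refine key 5 4 rfl ?_
    simp [hexVertex, dot2, det2]; constructor <;> [skip; constructor] <;> linarith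

lemma hexVertex_disjoint {i j : ZMod 6} {p : ℝ × ℝ} (hi : 0 < det2 (hexVertex (i - 1)) p)
    (hi' : det2 (hexVertex i) p < 0) (hj : 0 < det2 (hexVertex (j - 1)) p)
    (hj' : det2 (hexVertex j) p < 0) : i = j := by
  obtain ⟨h2, h3, h4, h5⟩ := hexVertex_rel p
  have h01 : (0 : ZMod 6) - 1 = 5 := rfl
  have h11 : (1 : ZMod 6) - 1 = 0 := rfl
  have h21 : (2 : ZMod 6) - 1 = 1 := rfl
  have h31 : (3 : ZMod 6) - 1 = 2 := rfl
  have h41 : (4 : ZMod 6) - 1 = 3 := rfl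
  have h51 : (5 : ZMod 6) - 1 = 4 := rfl
  have hcase (k : ZMod 6) : k = 0 ∨ k = 1 ∨ k = 2 ∨ k = 3 ∨ k = 4 ∨ k = 5 := by
    revert k; decide
  by_contra hne
  rcases hcase i with rfl | rfl | rfl | rfl | rfl | rfl <;>
    rcases hcase j with rfl | rfl | rfl | rfl | rfl | rfl <;>
    first
    | exact hne rfl
    | (simp only [h01, h11, h21, h31, h41, h51] at hi hj; linarith)

lemma hexVertex_cover (p : ℝ × ℝ) :
    ∃ i : ZMod 6, 0 ≤ det2 (hexVertex (i - 1)) p ∧ det2 (hexVertex i) p ≤ 0 := by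
  obtain ⟨h2, h3, h4, h5⟩ := hexVertex_rel p
  rcases le_or_gt 0 (det2 (hexVertex 0) p) with h0 | h0
  · rcases le_or_gt (det2 (hexVertex 1) p) 0 with h1 | h1
    · exact ⟨1, h0, h1⟩
    rcases le_or_gt (det2 (hexVertex 2) p) 0 with h | h
    · exact ⟨2, h1.le, h⟩
    · exact ⟨3, h.le, by linarith⟩
  · rcases le_or_gt (det2 (hexVertex 4) p) 0 with h1 | h1
    · exact ⟨4, show 0 ≤ det2 (hexVertex 3) p by linarith, h1⟩
    rcases le_or_gt (det2 (hexVertex 5) p) 0 with h | h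
    · exact ⟨5, h1.le, h⟩
    · exact ⟨0, h.le, h0.le⟩

lemma half_le_sqrt_three_div_two : 1 / 2 ≤ √3 / 2 := by
  have : 1 ≤ √3 := Real.one_le_sqrt.2 (by norm_num)
  linarith

lemma nrm2_hexVertex (i : ZMod 6) : nrm2 (hexVertex i) = 1 := by
  rw [nrm2, (hexVertex_dot i).1, Real.sqrt_one]

lemma det2_hexVertex_pos (i : ZMod 6) : 0 < det2 (hexVertex (i - 1)) (hexVertex i) := by
  rw [(hexVertex_dot i).2.2]; positivity

lemma det2_swap (a b : ℝ × ℝ) : det2 a b = -det2 b a := by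
  simp [det2]; ring

/-- The patch of six equilateral triangles around the origin. -/
def hexPatch : TrianglePatch 6 where
  hq := by norm_num
  z := (0, 0)
  A := hexVertex
  indep i := affineIndependent_of_det2_ne_zero (det2_hexVertex_pos i).ne'
  disj i j hij := by
    refine Set.disjoint_left.2 fun p hi hj => hij ?_
    have key {k : ZMod 6} (hk : p ∈ tri (0, 0) (hexVertex (k - 1)) (hexVertex k)) :
        0 < det2 (hexVertex (k - 1)) p ∧ det2 (hexVertex k) p < 0 := by
      have hk0 := det2_hexVertex_pos k
      obtain ⟨s, t, hs, ht, -, rfl⟩ := (mem_tri_zero hk0.ne' _).1 hk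
      rw [det2_swap (hexVertex k), det2_comb_left, det2_comb_right, neg_lt_zero]
      exact ⟨mul_pos ht hk0, mul_pos hs hk0⟩
    exact hexVertex_disjoint (key hi).1 (key hi).2 (key hj).1 (key hj).2
  covers := by
    refine ⟨1 / 8, by norm_num, fun p hp => Set.mem_iUnion.2 ?_⟩
    obtain ⟨i, h1, h2⟩ := hexVertex_cover p
    have hi := det2_hexVertex_pos i
    refine ⟨i, ?_⟩
    have hcl : closure (tri (0, 0) (hexVertex (i - 1)) (hexVertex i)) =
        closure (convexHull ℝ {0, hexVertex (i - 1), hexVertex i}) :=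
      (convex_convexHull ℝ _).closure_interior_eq_closure_of_nonempty_interior
        (tri_zero_nonempty hi.ne')
    rw [hcl]
    refine subset_closure ((mem_convexHull_zero p).2 ⟨_, _, ?_, ?_, ?_, eq_comb hi.ne' p⟩)
    · rw [det2_swap] at h2
      exact div_nonneg (by linarith) hi.le
    · exact div_nonneg h1 hi.le
    · have hn (k : ZMod 6) : ‖hexVertex k‖ ≤ 1 := (norm_le_nrm2 _).trans_eq (nrm2_hexVertex k)
      have h3 := (abs_le.1 (abs_det2_le_norm p (hn i))).2
      have h4 := (abs_le.1 (abs_det2_le_norm p (hn (i - 1)))).1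
      rw [det2_swap] at h4
      have h5 : ‖p‖ < 1 / 8 :=
        mem_ball_zero_iff.1 (show p ∈ Metric.ball (0 : ℝ × ℝ) (1 / 8) from hp)
      rw [← add_div, div_le_one hi, (hexVertex_dot i).2.2]
      linarith [half_le_sqrt_three_div_two]

lemma ang_eq_pi_div_three {u v : ℝ × ℝ} (hu : dot2 u u = 1) (hv : dot2 v v = 1)
    (huv : dot2 u v = 1 / 2) : ang u v = Real.pi / 3 := by
  rw [ang, nrm2, nrm2, hu, hv, huv, Real.sqrt_one, mul_one, div_one, ← Real.cos_pi_div_three,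
    Real.arccos_cos (by positivity) (by linarith [Real.pi_pos])]

lemma goodPatch_hexPatch {δ : ℝ} (hδ : δ ≤ Real.pi / 3) : goodPatch 6 δ 1 hexPatch := by
  refine ⟨rfl, rfl, one_pos, fun i => ?_⟩
  have hz : hexPatch.z = 0 := rfl
  have hA : hexPatch.A = hexVertex := rfl
  rw [hz, hA, sub_zero, sub_zero]
  obtain ⟨h1, h2, -⟩ := hexVertex_dot i
  have h0 := (hexVertex_dot (i - 1)).1
  generalize hexVertex (i - 1) = a at *
  have hn := nrm2_hexVertex i
  generalize hexVertex i = b at *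
  simp only [dot2] at h0 h1 h2
  refine ⟨hδ.trans_eq (ang_eq_pi_div_three ?_ ?_ ?_).symm,
    hδ.trans_eq (ang_eq_pi_div_three ?_ ?_ ?_).symm,
    hδ.trans_eq (ang_eq_pi_div_three ?_ ?_ ?_).symm, hn.ge⟩ <;>
    simp [dot2] <;> linarith

/-- Fix `n ≥ 1` and `δ ∈ (0, π/3]`.  With
`c̃_n(q,δ,ρ) = inf_{𝒯 ∈ X_{q,δ,ρ}} ĉ_n(𝒯)`, the infimum of `c̃_n(q,δ,ρ)` over all
`ρ > 0` and all integers `q ≥ 3` (with `X_{q,δ,ρ}` nonempty) is strictly positive. -/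
theorem statement19 (n : ℕ) (hn : 1 ≤ n) (del : ℝ) (hd : 0 < del)
    (hd' : del ≤ Real.pi / 3) :
    0 < sInf {c : ℝ | ∃ q : ℕ, 3 ≤ q ∧ ∃ rho : ℝ, 0 < rho ∧
        (∃ T : TrianglePatch q, goodPatch q del rho T) ∧
        c = sInf {e : ℝ | ∃ T : TrianglePatch q, goodPatch q del rho T ∧ e = chat n T}} := by
  obtain ⟨ε, hε, hle⟩ := exists_le_chat_of_goodPatch n hn hd (by linarith [Real.pi_pos])
  refine hε.trans_le (le_csInf
    ⟨_, 6, by norm_num, 1, one_pos, ⟨hexPatch, goodPatch_hexPatch hd'⟩, rfl⟩ ?_)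
  rintro _ ⟨q, -, rho, -, ⟨T, hT⟩, rfl⟩
  refine le_csInf ⟨_, T, hT, rfl⟩ ?_
  rintro _ ⟨T', hT', rfl⟩
  exact hle q rho T' hT'
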